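/- arXiv:2508.03994 — 3 statements merged into one kernel-verified Lean document; each statement's English description precedes it below -/
import Mathlib

section
/- Optimizers of entropy-plus-quadratic objectives have full-rank outputs: Let φ be a density matrix on ℂ^{d_R} with support projection Π := Π^φ. Let f_Q be a real-valued quadratic polynomial on the real vector space of Hermitian matrices on ℂ^{d_B}⊗ℂ^{d_R}, i.e., f_Q(N) = B(N,N) + L(N) + c for a symmetric ℝ-bilinear form B, an ℝ-linear functional L, and a constant c. Let g_1,…,g_{J'} be ℝ-linear functionals on Hermitian matrices. Consider maximizing f(N) := S((1_B⊗√φ) N (1_B⊗√φ)) + f_Q(N) over Choi matrices N subject to g_j(N) ≤ 0 for all j, and assume there is a positive definite Choi matrix satisfying all the constraints g_j(N) ≤ 0. Then every maximizer N of this problem satisfies: the range of (1_B⊗√φ) N (1_B⊗√φ) equals the range of 1_B⊗Π (i.e., the output has full rank within the support of 1_B⊗Π^φ). -/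
/-! Statement 5: Optimizers of entropy-plus-quadratic objectives have full-rank outputs. -/

noncomputable section
open scoped Kronecker ComplexOrder
open Matrix

namespace ThermalPaper

/-- Functional calculus for Hermitian matrices (junk value `0` on non-Hermitian input). -/
def hermCFC {n : Type*} [Fintype n] [DecidableEq n] (f : ℝ → ℝ)
    (A : Matrix n n ℂ) : Matrix n n ℂ :=
  if hA : A.IsHermitian then
    (hA.eigenvectorUnitary : Matrix n n ℂ) *
      Matrix.diagonal (fun i => (f (hA.eigenvalues i) : ℂ)) *
      star (hA.eigenvectorUnitary : Matrix n n ℂ)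
  else 0

/-- Matrix logarithm of a Hermitian matrix, with the convention `log 0 = 0`. -/
def matLog {n : Type*} [Fintype n] [DecidableEq n] (A : Matrix n n ℂ) : Matrix n n ℂ :=
  hermCFC Real.log A

/-- Positive semidefinite square root of a positive semidefinite matrix. -/
def matSqrt {n : Type*} [Fintype n] [DecidableEq n] (A : Matrix n n ℂ) : Matrix n n ℂ :=
  hermCFC Real.sqrt A

/-- `X^{-1/2}`: the PSD square root of the Moore–Penrose pseudoinverse of `X`. -/
def matPinvSqrt {n : Type*} [Fintype n] [DecidableEq n] (A : Matrix n n ℂ) : Matrix n n ℂ :=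
  hermCFC (fun x => Real.sqrt x⁻¹) A

/-- `Π^X`: orthogonal projection onto the range (support) of a PSD matrix `X`. -/
def suppProj {n : Type*} [Fintype n] [DecidableEq n] (A : Matrix n n ℂ) : Matrix n n ℂ :=
  hermCFC (fun x => if x = 0 then 0 else 1) A

/-- Von Neumann entropy `S(X) = −tr(X log X)`. -/
def vnEnt {n : Type*} [Fintype n] [DecidableEq n] (A : Matrix n n ℂ) : ℝ :=
  -(Matrix.trace (A * matLog A)).re

/-- A density matrix: positive semidefinite with unit trace. -/
def IsDensity {n : Type*} [Fintype n] [DecidableEq n] (ρ : Matrix n n ℂ) : Prop :=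
  ρ.PosSemidef ∧ Matrix.trace ρ = 1

variable {dB dR : ℕ}

/-- Partial trace over the `B` factor. -/
def ptraceB (N : Matrix (Fin dB × Fin dR) (Fin dB × Fin dR) ℂ) :
    Matrix (Fin dR) (Fin dR) ℂ :=
  Matrix.of fun r r' => ∑ b : Fin dB, N (b, r) (b, r')

/-- A Choi matrix: positive semidefinite with `tr_B N = 1`. -/
def IsChoi (N : Matrix (Fin dB × Fin dR) (Fin dB × Fin dR) ℂ) : Prop :=
  N.PosSemidef ∧ ptraceB N = 1

/-- Channel conditional entropy `S_ρ(N)` with respect to the input state `ρ`. -/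
def condEnt (ρ : Matrix (Fin dR) (Fin dR) ℂ)
    (N : Matrix (Fin dB × Fin dR) (Fin dB × Fin dR) ℂ) : ℝ :=
  vnEnt (((1 : Matrix (Fin dB) (Fin dB) ℂ) ⊗ₖ matSqrt ρ) * N *
    ((1 : Matrix (Fin dB) (Fin dB) ℂ) ⊗ₖ matSqrt ρ)) - vnEnt ρ

/-- Channel entropy: the infimum of `S_ρ(N)` over density matrices `ρ`. -/
def chanEnt (N : Matrix (Fin dB × Fin dR) (Fin dB × Fin dR) ℂ) : ℝ :=
  sInf {x : ℝ | ∃ ρ : Matrix (Fin dR) (Fin dR) ℂ, IsDensity ρ ∧ condEnt ρ N = x}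

section Helpers

variable {n : Type*} [Fintype n] [DecidableEq n]

lemma hermCFC_mul (f g : ℝ → ℝ) {A : Matrix n n ℂ} (hA : A.IsHermitian) :
    hermCFC f A * hermCFC g A = hermCFC (fun x => f x * g x) A := by
  unfold hermCFC
  simp only [hA, dif_pos]
  have h : star (hA.eigenvectorUnitary : Matrix n n ℂ) * (hA.eigenvectorUnitary : Matrix n n ℂ) = 1 :=
    Unitary.coe_star_mul_self _
  calc _ = (hA.eigenvectorUnitary : Matrix n n ℂ) * Matrix.diagonal (fun i => (f (hA.eigenvalues i) : ℂ)) *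
        (star (hA.eigenvectorUnitary : Matrix n n ℂ) * (hA.eigenvectorUnitary : Matrix n n ℂ)) *
        Matrix.diagonal (fun i => (g (hA.eigenvalues i) : ℂ)) *
        star (hA.eigenvectorUnitary : Matrix n n ℂ) := by simp only [Matrix.mul_assoc]
    _ = _ := by
      rw [h, Matrix.mul_one, Matrix.mul_assoc _ (diagonal _) (diagonal _), Matrix.diagonal_mul_diagonal]
      simp

lemma hermCFC_id {A : Matrix n n ℂ} (hA : A.IsHermitian) : hermCFC (fun x => x) A = A := by
  unfold hermCFC
  simp only [hA, dif_pos]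
  conv_rhs => rw [hA.spectral_theorem, Unitary.conjStarAlgAut_apply]
  rfl

lemma hermCFC_herm (f : ℝ → ℝ) (A : Matrix n n ℂ) : (hermCFC f A)ᴴ = hermCFC f A := by
  unfold hermCFC
  split_ifs with hA
  · simp only [Matrix.conjTranspose_mul, Matrix.diagonal_conjTranspose, Matrix.star_eq_conjTranspose,
      Matrix.conjTranspose_conjTranspose, Matrix.mul_assoc]
    congr 3
    ext i
    simp
  · simp

lemma hermCFC_congr (f g : ℝ → ℝ) {A : Matrix n n ℂ} (hA : A.IsHermitian)
    (h : ∀ i, f (hA.eigenvalues i) = g (hA.eigenvalues i)) : hermCFC f A = hermCFC g A := by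
  unfold hermCFC
  simp only [hA, dif_pos, h]

lemma matSqrt_mul_self {A : Matrix n n ℂ} (hA : A.PosSemidef) : matSqrt A * matSqrt A = A := by
  unfold matSqrt
  rw [hermCFC_mul _ _ hA.1]
  conv_rhs => rw [← hermCFC_id hA.1]
  exact hermCFC_congr _ _ hA.1 fun i => Real.mul_self_sqrt (hA.eigenvalues_nonneg i)

lemma matSqrt_mul_pinv {A : Matrix n n ℂ} (hA : A.PosSemidef) :
    matSqrt A * matPinvSqrt A = suppProj A := by
  unfold matSqrt matPinvSqrt suppProj
  rw [hermCFC_mul _ _ hA.1]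
  refine hermCFC_congr _ _ hA.1 fun i => ?_
  have := hA.eigenvalues_nonneg i
  split_ifs with h
  · simp [h]
  · rw [← Real.sqrt_mul this, mul_inv_cancel₀ h, Real.sqrt_one]

lemma suppProj_mul_matSqrt {A : Matrix n n ℂ} (hA : A.PosSemidef) :
    suppProj A * matSqrt A = matSqrt A := by
  unfold matSqrt suppProj
  rw [hermCFC_mul _ _ hA.1]
  refine hermCFC_congr _ _ hA.1 fun i => ?_
  split_ifs with h
  · simp [h]
  · simp

lemma trace_hermCFC (f : ℝ → ℝ) {A : Matrix n n ℂ} (hA : A.IsHermitian) :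
    (hermCFC f A).trace = ∑ i, (f (hA.eigenvalues i) : ℂ) := by
  unfold hermCFC
  simp only [hA, dif_pos]
  rw [Matrix.trace_mul_comm, ← Matrix.mul_assoc, Unitary.coe_star_mul_self, Matrix.one_mul,
    Matrix.trace_diagonal]

lemma vnEnt_eq {A : Matrix n n ℂ} (hA : A.IsHermitian) :
    vnEnt A = ∑ i, Real.negMulLog (hA.eigenvalues i) := by
  unfold vnEnt matLog
  have : A * hermCFC Real.log A = hermCFC (fun x => x * Real.log x) A := by
    rw [← hermCFC_mul (fun x => x) Real.log hA, hermCFC_id hA]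
  rw [this, trace_hermCFC _ hA, ← Complex.ofReal_sum, Complex.ofReal_re, ← Finset.sum_neg_distrib]
  exact Finset.sum_congr rfl fun i _ => by rw [Real.negMulLog]; ring

/-- column norms of a unitary -/
lemma unit_row (P : Matrix n n ℂ) (h : P * Pᴴ = 1) (i : n) : ∑ j, ‖P i j‖ ^ 2 = 1 := by
  have := congrFun (congrFun h i) i
  simp only [Matrix.mul_apply, Matrix.conjTranspose_apply, Matrix.one_apply_eq, RCLike.star_def,
    Complex.mul_conj'] at this
  exact_mod_cast this

lemma peierls {X V : Matrix n n ℂ} (hX : X.PosSemidef) (hV : Vᴴ * V = 1) :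
    vnEnt X ≤ ∑ i, Real.negMulLog ((Vᴴ * X * V) i i).re := by
  rw [vnEnt_eq hX.1]
  have hV' : V * Vᴴ = 1 := mul_eq_one_comm.mp hV
  set W : Matrix n n ℂ := (hX.1.eigenvectorUnitary : Matrix n n ℂ) with hW
  have hW1 : Wᴴ * W = 1 := Unitary.coe_star_mul_self _
  have hW2 : W * Wᴴ = 1 := mul_eq_one_comm.mp hW1
  set P := Vᴴ * W with hP
  have hPH : Pᴴ = Wᴴ * V := by simp [hP, Matrix.conjTranspose_mul]
  have hP1 : P * Pᴴ = 1 := by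
    rw [hPH, hP, Matrix.mul_assoc, ← Matrix.mul_assoc W, hW2, Matrix.one_mul, hV]
  have hP2 : Pᴴ * Pᴴᴴ = 1 := by
    rw [Matrix.conjTranspose_conjTranspose]; exact mul_eq_one_comm.mp hP1
  have hd : ∀ i, ((Vᴴ * X * V) i i).re = ∑ j, ‖P i j‖ ^ 2 * hX.1.eigenvalues j := by
    intro i
    have hXe : X = W * diagonal (fun i => (hX.1.eigenvalues i : ℂ)) * Wᴴ := by
      have := hermCFC_id hX.1
      rw [hermCFC, dif_pos hX.1] at this
      exact this.symm
    have : Vᴴ * X * V = P * diagonal (fun i => (hX.1.eigenvalues i : ℂ)) * Pᴴ := by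
      rw [hPH, hP]
      conv_lhs => rw [hXe]
      simp only [Matrix.mul_assoc]
    rw [this, Matrix.mul_apply]
    have h2 : ∀ j, (P * diagonal (fun i => (hX.1.eigenvalues i : ℂ))) i j * Pᴴ j i
        = ((‖P i j‖ ^ 2 * hX.1.eigenvalues j : ℝ) : ℂ) := by
      intro j
      have h3 : P i j * star (P i j) = ((‖P i j‖ ^ 2 : ℝ) : ℂ) := by
        rw [RCLike.star_def, Complex.mul_conj']; push_cast; rfl
      rw [Matrix.mul_diagonal, Matrix.conjTranspose_apply, mul_right_comm, h3, Complex.ofReal_mul]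
    rw [Finset.sum_congr rfl fun j _ => h2 j, ← Complex.ofReal_sum, Complex.ofReal_re]
  have hj : ∀ i, ∑ j, ‖P i j‖ ^ 2 * Real.negMulLog (hX.1.eigenvalues j) ≤
      Real.negMulLog ((Vᴴ * X * V) i i).re := by
    intro i
    rw [hd]
    have := Real.concaveOn_negMulLog.le_map_sum (t := Finset.univ) (w := fun j => ‖P i j‖ ^ 2)
      (p := hX.1.eigenvalues) (fun j _ => by positivity) (unit_row P hP1 i)
      (fun j _ => hX.eigenvalues_nonneg j)
    simpa using this
  calc _ = ∑ i, ∑ j, ‖P i j‖ ^ 2 * Real.negMulLog (hX.1.eigenvalues j) := by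
        rw [Finset.sum_comm]
        refine Finset.sum_congr rfl fun j _ => ?_
        rw [← Finset.sum_mul]
        have := unit_row _ hP2 j
        simp only [Matrix.conjTranspose_apply, norm_star] at this
        rw [this, one_mul]
    _ ≤ _ := Finset.sum_le_sum fun i _ => hj i

/-- scalar estimate -/
lemma scalar_est {a m t l p C : ℝ} (ha : 0 ≤ a) (hm : 0 ≤ m) (ht : 0 < t) (ht1 : t < 1)
    (hl : l = (1 - t) * a + t * m) (hl1 : l ≤ 1) (hC : 0 < C) (hp : 0 ≤ p) (hpm : p ≤ C * m) :
    (1 - t) * (Real.negMulLog a + a - l) + t * C⁻¹ * (p * (-Real.log t) + p - p * l / t)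
      ≤ Real.negMulLog l := by
  have h1t : 0 < 1 - t := by linarith
  have hl0 : 0 ≤ l := by rw [hl]; positivity
  rcases hl0.eq_or_lt with h0 | h0
  · have e1 : (1 - t) * a = 0 := by nlinarith [mul_nonneg h1t.le ha, mul_nonneg ht.le hm]
    have e2 : t * m = 0 := by nlinarith [mul_nonneg h1t.le ha, mul_nonneg ht.le hm]
    have a0 : a = 0 := by simpa [h1t.ne'] using e1
    have m0 : m = 0 := by simpa [ht.ne'] using e2
    have p0 : p = 0 := by subst m0; linarith
    simp [← h0, a0, p0]
  · have k1 : Real.negMulLog a + a - l ≤ - a * Real.log l := by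
      rcases ha.eq_or_lt with h | h
      · simp [← h]; exact h0.le
      · have := Real.log_le_sub_one_of_pos (div_pos h0 h)
        rw [Real.log_div h0.ne' h.ne'] at this
        have h3 := mul_le_mul_of_nonneg_left this h.le
        have : a * (l / a - 1) = l - a := by field_simp
        rw [Real.negMulLog]; linarith
    have hlog : Real.log l ≤ 0 := Real.log_nonpos hl0 hl1
    have k2 : p * (-Real.log t) + p - p * l / t ≤ p * (-Real.log l) := by
      have := Real.log_le_sub_one_of_pos (div_pos h0 ht)
      rw [Real.log_div h0.ne' ht.ne'] at this
      have h3 := mul_le_mul_of_nonneg_left this hp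
      have e : p * (l / t - 1) = p * l / t - p := by ring
      linarith
    have k3 : C⁻¹ * (p * (-Real.log l)) ≤ m * (-Real.log l) := by
      rw [← mul_assoc]
      refine mul_le_mul_of_nonneg_right ?_ (by linarith)
      rw [inv_mul_le_iff₀ hC]; exact hpm
    have k4 := mul_le_mul_of_nonneg_left k1 h1t.le
    have k5 := mul_le_mul_of_nonneg_left k2 (inv_pos.mpr hC).le
    have k6 := mul_le_mul_of_nonneg_left (k5.trans k3) ht.le
    have : Real.negMulLog l = (1 - t) * (-a * Real.log l) + t * (m * (-Real.log l)) := by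
      rw [Real.negMulLog]; nth_rewrite 1 [hl]; ring
    rw [this, mul_assoc]
    linarith

lemma diag_re_nonneg {A : Matrix n n ℂ} (hA : A.PosSemidef) (i : n) : 0 ≤ (A i i).re := by
  have := hA.diag_nonneg (i := i)
  exact (Complex.nonneg_iff.mp this).1

lemma core {A Z : Matrix n n ℂ} (hA : A.PosSemidef) (hAt : A.trace = 1)
    (hMt : (Zᴴ * Z).trace = 1) (y : n → ℂ) (hv : Zᴴ *ᵥ y ≠ 0) (hAv : A *ᵥ (Zᴴ *ᵥ y) = 0) :
    ∃ c C' : ℝ, 0 < c ∧ ∀ t : ℝ, 0 < t → t < 1 →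
      vnEnt A + t * (c * (-Real.log t) - C') ≤ vnEnt ((1 - t) • A + t • (Zᴴ * Z)) := by
  set v := Zᴴ *ᵥ y with hvdef
  set M := Zᴴ * Z with hM
  have hMp : M.PosSemidef := Matrix.posSemidef_conjTranspose_mul_self Z
  set s : ℝ := ∑ i, ‖v i‖ ^ 2 with hs
  set C : ℝ := ∑ i, ‖y i‖ ^ 2 with hCdef
  have hspos : 0 < s := by
    obtain ⟨i, hi⟩ := Function.ne_iff.mp hv
    have : 0 < ‖v i‖ ^ 2 := by have := norm_pos_iff.mpr hi; positivity
    exact this.trans_le (Finset.single_le_sum (f := fun i => ‖v i‖ ^ 2) (fun _ _ => by positivity) (Finset.mem_univ i))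
  have hCpos : 0 < C := by
    have hy : y ≠ 0 := by rintro rfl; exact hv (by simp [hvdef])
    obtain ⟨i, hi⟩ := Function.ne_iff.mp hy
    have : 0 < ‖y i‖ ^ 2 := by have := norm_pos_iff.mpr hi; positivity
    exact this.trans_le (Finset.single_le_sum (f := fun i => ‖y i‖ ^ 2) (fun _ _ => by positivity) (Finset.mem_univ i))
  set mv : ℝ := (star v ⬝ᵥ (M *ᵥ v)).re with hmv
  refine ⟨C⁻¹ * s, vnEnt A - C⁻¹ * (s - mv), by positivity, fun t ht ht1 => ?_⟩
  set T := (1 - t) • A + t • M with hT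
  have hTp : T.PosSemidef := (hA.smul (by linarith : (0:ℝ) ≤ 1 - t)).add (hMp.smul ht.le)
  set V : Matrix n n ℂ := (hTp.1.eigenvectorUnitary : Matrix n n ℂ) with hVdef
  have hV1 : Vᴴ * V = 1 := Unitary.coe_star_mul_self _
  have hV2 : V * Vᴴ = 1 := mul_eq_one_comm.mp hV1
  set l := hTp.1.eigenvalues with hl
  have hTe : T = V * diagonal (fun i => (l i : ℂ)) * Vᴴ := by
    have := hermCFC_id hTp.1
    rw [hermCFC, dif_pos hTp.1] at this
    exact this.symm
  have hVT : Vᴴ * T * V = diagonal (fun i => (l i : ℂ)) := by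
    rw [hTe, ← Matrix.mul_assoc, ← Matrix.mul_assoc, hV1, Matrix.one_mul, Matrix.mul_assoc, hV1,
      Matrix.mul_one]
  set a : n → ℝ := fun i => ((Vᴴ * A * V) i i).re with ha
  set m : n → ℝ := fun i => ((Vᴴ * M * V) i i).re with hm
  set p : n → ℝ := fun i => ‖(Vᴴ *ᵥ v) i‖ ^ 2 with hp
  have hlam : ∀ i, l i = (1 - t) * a i + t * m i := by
    intro i
    have h1 : ((Vᴴ * T * V) i i).re = l i := by rw [hVT]; simp
    rw [← h1, hT, Matrix.mul_add, Matrix.add_mul]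
    simp [ha, hm]
  have ha0 : ∀ i, 0 ≤ a i := fun i => diag_re_nonneg (hA.conjTranspose_mul_mul_same V) i
  have hm0 : ∀ i, 0 ≤ m i := fun i => diag_re_nonneg (hMp.conjTranspose_mul_mul_same V) i
  have htr : ∀ X : Matrix n n ℂ, X.trace = 1 → ∑ i, ((Vᴴ * X * V) i i).re = 1 := by
    intro X hX
    have : (Vᴴ * X * V).trace = 1 := by
      rw [Matrix.trace_mul_comm, ← Matrix.mul_assoc, hV2, Matrix.one_mul, hX]
    rw [← Complex.re_sum]
    have := congrArg Complex.re this
    simpa [Matrix.trace] using this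
  have hasum : ∑ i, a i = 1 := htr A hAt
  have hmsum : ∑ i, m i = 1 := htr M hMt
  have hlsum : ∑ i, l i = 1 := by
    rw [Finset.sum_congr rfl fun i _ => hlam i, Finset.sum_add_distrib, ← Finset.mul_sum,
      ← Finset.mul_sum, hasum, hmsum]; ring
  have hl0 : ∀ i, 0 ≤ l i := hTp.eigenvalues_nonneg
  have hl1 : ∀ i, l i ≤ 1 := fun i => by
    rw [← hlsum]; exact Finset.single_le_sum (fun i _ => hl0 i) (Finset.mem_univ i)
  have hpm : ∀ i, p i ≤ C * m i := by
    intro i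
    have e1 : (Vᴴ *ᵥ v) i = ∑ k, star ((Z * V) k i) * y k := by
      rw [hvdef, Matrix.mulVec_mulVec, ← Matrix.conjTranspose_mul]
      rfl
    have e2 : m i = ∑ k, ‖(Z * V) k i‖ ^ 2 := by
      have : Vᴴ * M * V = (Z * V)ᴴ * (Z * V) := by
        rw [hM, Matrix.conjTranspose_mul]; simp only [Matrix.mul_assoc]
      simp only [hm]
      rw [this, Matrix.mul_apply, Complex.re_sum]
      refine Finset.sum_congr rfl fun k _ => ?_
      rw [Matrix.conjTranspose_apply, RCLike.star_def, Complex.conj_mul']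
      norm_cast
    have e3 : ‖(Vᴴ *ᵥ v) i‖ ≤ ∑ k, ‖(Z * V) k i‖ * ‖y k‖ := by
      rw [e1]
      refine (norm_sum_le _ _).trans (le_of_eq ?_)
      simp [norm_mul]
    calc p i ≤ (∑ k, ‖(Z * V) k i‖ * ‖y k‖) ^ 2 := by
          simp only [hp]; exact pow_le_pow_left₀ (norm_nonneg _) e3 2
      _ ≤ (∑ k, ‖(Z * V) k i‖ ^ 2) * ∑ k, ‖y k‖ ^ 2 := Finset.sum_mul_sq_le_sq_mul_sq _ _ _
      _ = _ := by rw [e2]; ring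
  have hpsum : ∑ i, p i = s := by
    have h1 : star (Vᴴ *ᵥ v) ⬝ᵥ (Vᴴ *ᵥ v) = star v ⬝ᵥ v := by
      rw [Matrix.star_mulVec, Matrix.conjTranspose_conjTranspose, ← Matrix.dotProduct_mulVec,
        Matrix.mulVec_mulVec, hV2, Matrix.one_mulVec]
    simp only [dotProduct, Pi.star_apply, RCLike.star_def, Complex.conj_mul'] at h1
    exact_mod_cast h1
  have hplsum : ∑ i, p i * l i = t * mv := by
    have h1 : star (Vᴴ *ᵥ v) ⬝ᵥ (diagonal (fun i => (l i : ℂ)) *ᵥ (Vᴴ *ᵥ v)) = star v ⬝ᵥ (T *ᵥ v) := by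
      rw [Matrix.star_mulVec, Matrix.conjTranspose_conjTranspose, ← Matrix.dotProduct_mulVec,
        Matrix.mulVec_mulVec, Matrix.mulVec_mulVec, hTe]
    have h2 : T *ᵥ v = t • (M *ᵥ v) := by
      rw [hT, Matrix.add_mulVec, Matrix.smul_mulVec, Matrix.smul_mulVec, hAv]; simp
    have h3 : star (Vᴴ *ᵥ v) ⬝ᵥ (diagonal (fun i => (l i : ℂ)) *ᵥ (Vᴴ *ᵥ v))
        = ((∑ i, p i * l i : ℝ) : ℂ) := by
      rw [Complex.ofReal_sum]
      refine Finset.sum_congr rfl fun i _ => ?_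
      rw [Matrix.mulVec_diagonal, Pi.star_apply, RCLike.star_def, mul_left_comm, Complex.conj_mul']
      simp only [hp]; push_cast; ring
    rw [h3, h2] at h1
    have := congrArg Complex.re h1
    rw [Complex.ofReal_re] at this
    rw [this, dotProduct_smul, Complex.smul_re, hmv, smul_eq_mul]
  rw [vnEnt_eq hTp.1]
  have hsum := Finset.sum_le_sum fun i (_ : i ∈ Finset.univ) =>
    scalar_est (ha0 i) (hm0 i) ht ht1 (hlam i) (hl1 i) hCpos (by positivity : 0 ≤ p i) (hpm i)
  refine le_trans ?_ hsum
  have hpei : vnEnt A ≤ ∑ i, Real.negMulLog (a i) := peierls hA hV1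
  have e : ∑ i, ((1 - t) * (Real.negMulLog (a i) + a i - l i) +
      t * C⁻¹ * (p i * (-Real.log t) + p i - p i * l i / t)) =
      (1 - t) * (∑ i, Real.negMulLog (a i)) + t * C⁻¹ * (s * (-Real.log t) + s - mv) := by
    rw [Finset.sum_add_distrib, ← Finset.mul_sum, ← Finset.mul_sum, Finset.sum_sub_distrib,
      Finset.sum_add_distrib, Finset.sum_sub_distrib, Finset.sum_add_distrib, ← Finset.sum_mul,
      ← Finset.sum_div, hasum, hlsum, hpsum, hplsum]
    field_simp
    ring
  rw [e]
  have := mul_le_mul_of_nonneg_left hpei (by linarith : 0 ≤ 1 - t)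
  nlinarith [this]

lemma range_dichotomy {K N : Matrix n n ℂ}
    (h : ∀ w, (K * N * K) *ᵥ (K *ᵥ w) = 0 → K *ᵥ w = 0) :
    LinearMap.range (Matrix.toLin' (K * N * K)) = LinearMap.range (Matrix.toLin' K) := by
  have hle : LinearMap.range (Matrix.toLin' (K * N * K)) ≤ LinearMap.range (Matrix.toLin' K) := by
    rw [Matrix.mul_assoc, Matrix.toLin'_mul]
    exact LinearMap.range_comp_le_range _ _
  refine le_antisymm hle ?_
  let R := LinearMap.range (Matrix.toLin' K)
  let F : R →ₗ[ℂ] R := LinearMap.restrict (Matrix.toLin' (K * N * K))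
    (fun x _ => hle ⟨x, rfl⟩)
  have hinj : Function.Injective F := by
    rw [← LinearMap.ker_eq_bot, LinearMap.ker_eq_bot']
    rintro ⟨x, w, rfl⟩ hx
    have := congrArg Subtype.val hx
    ext1
    simpa using h w (by simpa [F, LinearMap.restrict_apply, Matrix.mul_assoc] using this)
  have hsurj := LinearMap.injective_iff_surjective.mp hinj
  intro x hx
  obtain ⟨z, hz⟩ := hsurj ⟨x, hx⟩
  exact ⟨z, congrArg Subtype.val hz⟩

end Helpers

lemma trace_out {dB dR : ℕ} {K φ : Matrix (Fin dR) (Fin dR) ℂ} (hK : K * K = φ) (hφ : φ.trace = 1)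
    {N : Matrix (Fin dB × Fin dR) (Fin dB × Fin dR) ℂ} (hN : ptraceB N = 1) :
    (((1 : Matrix (Fin dB) (Fin dB) ℂ) ⊗ₖ K) * N * ((1 : Matrix (Fin dB) (Fin dB) ℂ) ⊗ₖ K)).trace = 1 := by
  rw [Matrix.trace_mul_comm, ← Matrix.mul_assoc, ← Matrix.mul_kronecker_mul, Matrix.one_mul, hK]
  have h : (((1 : Matrix (Fin dB) (Fin dB) ℂ) ⊗ₖ φ) * N).trace = (φ * ptraceB N).trace := by
    simp only [Matrix.trace, Matrix.diag, Matrix.mul_apply, Fintype.sum_prod_type,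
      Matrix.kroneckerMap_apply, Matrix.one_apply, ptraceB, Matrix.of_apply, Finset.mul_sum]
    rw [Finset.sum_comm]
    refine Finset.sum_congr rfl fun r _ => ?_
    rw [Finset.sum_comm (s := Finset.univ) (t := Finset.univ) (f := fun r' b => φ r r' * N (b, r') (b, r))]
    refine Finset.sum_congr rfl fun b _ => ?_
    rw [Finset.sum_eq_single b]
    · simp
    · intro b' _ hb
      simp [hb.symm]
    · simp
  rw [h, hN, Matrix.mul_one, hφ]

/-- **Optimizers of entropy-plus-quadratic objectives have full-rank outputs.** -/
theorem maximizer_has_full_rank_output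
    {dB dR J' : ℕ} (hdB : 1 ≤ dB) (hdR : 1 ≤ dR)
    (φ : Matrix (Fin dR) (Fin dR) ℂ) (hφ : IsDensity φ)
    -- a symmetric real bilinear form on Hermitian matrices
    (B : selfAdjoint (Matrix (Fin dB × Fin dR) (Fin dB × Fin dR) ℂ) →ₗ[ℝ]
         selfAdjoint (Matrix (Fin dB × Fin dR) (Fin dB × Fin dR) ℂ) →ₗ[ℝ] ℝ)
    (hBsymm : ∀ X Y, B X Y = B Y X)
    -- a real linear functional and a constant
    (L : selfAdjoint (Matrix (Fin dB × Fin dR) (Fin dB × Fin dR) ℂ) →ₗ[ℝ] ℝ) (c : ℝ)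
    -- real linear constraint functionals
    (g : Fin J' → (selfAdjoint (Matrix (Fin dB × Fin dR) (Fin dB × Fin dR) ℂ) →ₗ[ℝ] ℝ))
    -- the objective function
    (f : selfAdjoint (Matrix (Fin dB × Fin dR) (Fin dB × Fin dR) ℂ) → ℝ)
    (hf : ∀ N, f N =
      vnEnt (((1 : Matrix (Fin dB) (Fin dB) ℂ) ⊗ₖ matSqrt φ) * (N : Matrix (Fin dB × Fin dR) (Fin dB × Fin dR) ℂ) *
        ((1 : Matrix (Fin dB) (Fin dB) ℂ) ⊗ₖ matSqrt φ)) + B N N + L N + c)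
    -- strict feasibility: a positive definite Choi matrix satisfying all constraints
    (hstrict : ∃ N : selfAdjoint (Matrix (Fin dB × Fin dR) (Fin dB × Fin dR) ℂ),
      IsChoi (N : Matrix (Fin dB × Fin dR) (Fin dB × Fin dR) ℂ) ∧ (N : Matrix (Fin dB × Fin dR) (Fin dB × Fin dR) ℂ).PosDef ∧ ∀ j, g j N ≤ 0)
    -- a maximizer of the problem
    (N : selfAdjoint (Matrix (Fin dB × Fin dR) (Fin dB × Fin dR) ℂ))
    (hN : IsChoi (N : Matrix (Fin dB × Fin dR) (Fin dB × Fin dR) ℂ)) (hNg : ∀ j, g j N ≤ 0)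
    (hNmax : ∀ N' : selfAdjoint (Matrix (Fin dB × Fin dR) (Fin dB × Fin dR) ℂ),
      IsChoi (N' : Matrix (Fin dB × Fin dR) (Fin dB × Fin dR) ℂ) → (∀ j, g j N' ≤ 0) → f N' ≤ f N) :
    LinearMap.range (Matrix.toLin'
        (((1 : Matrix (Fin dB) (Fin dB) ℂ) ⊗ₖ matSqrt φ) * (N : Matrix (Fin dB × Fin dR) (Fin dB × Fin dR) ℂ) *
          ((1 : Matrix (Fin dB) (Fin dB) ℂ) ⊗ₖ matSqrt φ)))
      = LinearMap.range (Matrix.toLin'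
          ((1 : Matrix (Fin dB) (Fin dB) ℂ) ⊗ₖ suppProj φ)) := by
  set K : Matrix (Fin dB × Fin dR) (Fin dB × Fin dR) ℂ :=
    (1 : Matrix (Fin dB) (Fin dB) ℂ) ⊗ₖ matSqrt φ with hKdef
  have hKH : Kᴴ = K := by
    rw [hKdef, Matrix.conjTranspose_kronecker, Matrix.conjTranspose_one]
    congr 1
    exact hermCFC_herm _ _
  have hrange : LinearMap.range (Matrix.toLin' ((1 : Matrix (Fin dB) (Fin dB) ℂ) ⊗ₖ suppProj φ))
      = LinearMap.range (Matrix.toLin' K) := by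
    apply le_antisymm
    · have : (1 : Matrix (Fin dB) (Fin dB) ℂ) ⊗ₖ suppProj φ
          = K * ((1 : Matrix (Fin dB) (Fin dB) ℂ) ⊗ₖ matPinvSqrt φ) := by
        rw [hKdef, ← Matrix.mul_kronecker_mul, Matrix.one_mul, matSqrt_mul_pinv hφ.1]
      rw [this, Matrix.toLin'_mul]
      exact LinearMap.range_comp_le_range _ _
    · have : K = ((1 : Matrix (Fin dB) (Fin dB) ℂ) ⊗ₖ suppProj φ) * K := by
        rw [hKdef, ← Matrix.mul_kronecker_mul, Matrix.one_mul, suppProj_mul_matSqrt hφ.1]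
      rw [this, Matrix.toLin'_mul]
      exact LinearMap.range_comp_le_range _ _
  rw [hrange]
  apply range_dichotomy
  intro w hw
  by_contra hv
  obtain ⟨N0, hN0, hpd, hg0⟩ := hstrict
  set Q := matSqrt (N0 : Matrix (Fin dB × Fin dR) (Fin dB × Fin dR) ℂ) with hQ
  have hQQ : Q * Q = N0 := matSqrt_mul_self hN0.1
  have hQH : Qᴴ = Q := hermCFC_herm _ _
  set y := Q *ᵥ ((N0 : Matrix (Fin dB × Fin dR) (Fin dB × Fin dR) ℂ)⁻¹ *ᵥ w) with hy
  have hQy : Q *ᵥ y = w := by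
    rw [hy, Matrix.mulVec_mulVec, hQQ, Matrix.mulVec_mulVec,
      Matrix.mul_nonsing_inv _ ((Matrix.isUnit_iff_isUnit_det _).mp hpd.isUnit), Matrix.one_mulVec]
  have hZH : (Q * K)ᴴ = K * Q := by rw [Matrix.conjTranspose_mul, hQH, hKH]
  have hZy : (Q * K)ᴴ *ᵥ y = K *ᵥ w := by rw [hZH, ← Matrix.mulVec_mulVec, hQy]
  have hZZ : (Q * K)ᴴ * (Q * K) = K * N0 * K := by
    rw [hZH, ← hQQ]; simp only [Matrix.mul_assoc]
  have hA : (K * (N : Matrix (Fin dB × Fin dR) (Fin dB × Fin dR) ℂ) * K).PosSemidef := by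
    have := hN.1.conjTranspose_mul_mul_same K
    rwa [hKH] at this
  obtain ⟨k, C', hk, hent⟩ := core hA (trace_out (matSqrt_mul_self hφ.1) hφ.2 hN.2)
    (Z := Q * K) (by rw [hZZ]; exact trace_out (matSqrt_mul_self hφ.1) hφ.2 hN0.2) y
    (by rw [hZy]; exact hv) (by rw [hZy]; exact hw)
  have key : ∀ t : ℝ, 0 < t → t < 1 → k * (-Real.log t) ≤
      C' + |B N (N0 - N) + B (N0 - N) N + L (N0 - N)| + |B (N0 - N) (N0 - N)| := by
    intro t ht ht1
    have h1t : 0 ≤ 1 - t := by linarith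
    have hcoe : (((1 - t) • N + t • N0 : selfAdjoint (Matrix (Fin dB × Fin dR) (Fin dB × Fin dR) ℂ)) :
        Matrix (Fin dB × Fin dR) (Fin dB × Fin dR) ℂ) = (1 - t) • N.1 + t • N0.1 := rfl
    have hmax := hNmax ((1 - t) • N + t • N0) ?_ ?_
    · have he := hent t ht ht1
      rw [hZZ] at he
      have e1 : (1 - t) • (K * N.1 * K) + t • (K * N0.1 * K)
          = K * (((1 - t) • N + t • N0 : selfAdjoint (Matrix (Fin dB × Fin dR) (Fin dB × Fin dR) ℂ)) :
        Matrix (Fin dB × Fin dR) (Fin dB × Fin dR) ℂ) * K := by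
        rw [hcoe, Matrix.mul_add, Matrix.add_mul]
        simp
      rw [e1] at he
      rw [hf, hf] at hmax
      have e2 : (1 - t) • N + t • N0 = N + t • (N0 - N) := by
        rw [sub_smul, one_smul, smul_sub]; abel
      have hB : B ((1 - t) • N + t • N0) ((1 - t) • N + t • N0) = B N N
          + t * (B N (N0 - N) + B (N0 - N) N) + t * (t * B (N0 - N) (N0 - N)) := by
        rw [e2]
        generalize N0 - N = D
        simp only [map_add, map_smul, LinearMap.add_apply, LinearMap.smul_apply, smul_eq_mul]
        ring
      have hL : L ((1 - t) • N + t • N0) = L N + t * L (N0 - N) := by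
        rw [e2]
        generalize N0 - N = D
        simp only [map_add, map_smul, smul_eq_mul]
      rw [hB, hL] at hmax
      have h3 : t * (k * (-Real.log t) - C' + (B N (N0 - N) + B (N0 - N) N + L (N0 - N))
          + t * B (N0 - N) (N0 - N)) ≤ 0 := by linarith
      have h4 := nonpos_of_mul_nonpos_right h3 ht
      have h5 := neg_abs_le (B N (N0 - N) + B (N0 - N) N + L (N0 - N))
      have h6 : -|B (N0 - N) (N0 - N)| ≤ t * B (N0 - N) (N0 - N) := by
        have := neg_abs_le (B (N0 - N) (N0 - N))
        have h7 := abs_nonneg (B (N0 - N) (N0 - N))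
        nlinarith
      linarith
    · rw [hcoe]
      refine ⟨(hN.1.smul h1t).add (hN0.1.smul ht.le), ?_⟩
      have : ptraceB ((1 - t) • N.1 + t • N0.1) = (1 - t) • ptraceB N.1 + t • ptraceB N0.1 := by
        ext r r'
        simp [ptraceB, Finset.sum_add_distrib, Finset.mul_sum]
      rw [this, hN.2, hN0.2, ← add_smul]
      simp
    · intro j
      rw [map_add, map_smul, map_smul, smul_eq_mul, smul_eq_mul]
      have := mul_nonpos_of_nonneg_of_nonpos h1t (hNg j)
      have := mul_nonpos_of_nonneg_of_nonpos ht.le (hg0 j)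
      linarith
  set E := C' + |B N (N0 - N) + B (N0 - N) N + L (N0 - N)| + |B (N0 - N) (N0 - N)| with hE
  have hpos : 0 < (|E| + 1) / k := by positivity
  have := key (Real.exp (-((|E| + 1) / k))) (Real.exp_pos _) (by
    rw [Real.exp_lt_one_iff]; linarith)
  rw [Real.log_exp, neg_neg, mul_div_cancel₀ _ hk.ne'] at this
  linarith [le_abs_self E]

end ThermalPaper
end
end

section
/- Optimality condition for the thermodynamic capacity: Let d, d_E ≥ 1 and let {K_i}_{i∈I} be a finite family of d_E×d complex matrices with Σ_i K_i†K_i = 1_d, defining the quantum channel 𝒩(X) := Σ_i K_i X K_i† and its adjoint 𝒩†(Y) := Σ_i K_i† Y K_i. (i) If a density matrix φ on ℂ^d maximizes the function σ ↦ S(σ) − S(𝒩(σ)) over all density matrices σ on ℂ^d, then there exists λ ∈ ℝ such that log φ − 𝒩†(log 𝒩(φ)) = λ · Π^φ. (ii) Conversely, if a positive definite density matrix φ on ℂ^d satisfies log φ − 𝒩†(log 𝒩(φ)) = λ · 1_d for some λ ∈ ℝ, then φ maximizes σ ↦ S(σ) − S(𝒩(σ)) over all density matrices σ on ℂ^d.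 -/
/-! Statement 9: Optimality condition for the thermodynamic capacity. -/

noncomputable section
open scoped Kronecker ComplexOrder
open Matrix

namespace ThermalPaper

variable {dB dR : ℕ}

section helpers
variable {n m : Type*} [Fintype n] [DecidableEq n] [Fintype m] [DecidableEq m]

/-- Spectral form `U diag(f) U†`. -/
def sp (U : Matrix n n ℂ) (f : n → ℝ) : Matrix n n ℂ :=
  U * Matrix.diagonal (fun i => (f i : ℂ)) * Uᴴ

/-- Unitary matrices, both identities. -/
def IsU (U : Matrix n n ℂ) : Prop := Uᴴ * U = 1 ∧ U * Uᴴ = 1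

lemma sp_mul {U : Matrix n n ℂ} (hU : IsU U) (f g : n → ℝ) :
    sp U f * sp U g = sp U (fun i => f i * g i) := by
  unfold sp
  calc _ = U * Matrix.diagonal (fun i => (f i : ℂ)) * (Uᴴ * U) *
        Matrix.diagonal (fun i => (g i : ℂ)) * Uᴴ := by simp only [Matrix.mul_assoc]
    _ = _ := by
      rw [hU.1, Matrix.mul_one, Matrix.mul_assoc U, Matrix.diagonal_mul_diagonal]
      simp

lemma sp_add (U : Matrix n n ℂ) (f g : n → ℝ) :
    sp U f + sp U g = sp U (fun i => f i + g i) := by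
  unfold sp
  rw [← Matrix.add_mul, ← Matrix.mul_add, Matrix.diagonal_add]
  simp

lemma sp_smul (U : Matrix n n ℂ) (c : ℝ) (f : n → ℝ) :
    (c : ℂ) • sp U f = sp U (fun i => c * f i) := by
  unfold sp
  rw [← Matrix.smul_mul, ← Matrix.mul_smul, ← Matrix.diagonal_smul]
  congr 3
  ext i
  simp

lemma sp_one {U : Matrix n n ℂ} (hU : IsU U) : sp U (fun _ => 1) = 1 := by
  unfold sp
  simp [hU.2]

lemma sp_zero (U : Matrix n n ℂ) : sp U (fun _ => 0) = 0 := by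
  unfold sp
  simp

lemma sp_herm (U : Matrix n n ℂ) (f : n → ℝ) : (sp U f)ᴴ = sp U f := by
  unfold sp
  simp only [Matrix.conjTranspose_mul, Matrix.conjTranspose_conjTranspose,
    Matrix.diagonal_conjTranspose, Matrix.mul_assoc]
  congr 3
  ext i
  simp

lemma sp_trace {U : Matrix n n ℂ} (hU : IsU U) (f : n → ℝ) :
    Matrix.trace (sp U f) = ((∑ i, f i : ℝ) : ℂ) := by
  unfold sp
  rw [Matrix.trace_mul_comm, ← Matrix.mul_assoc, hU.1, Matrix.one_mul, Matrix.trace_diagonal]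
  simp

lemma sp_posSemidef (U : Matrix n n ℂ) (f : n → ℝ) (hf : ∀ i, 0 ≤ f i) :
    (sp U f).PosSemidef := by
  unfold sp
  apply Matrix.PosSemidef.mul_mul_conjTranspose_same
  rw [Matrix.posSemidef_diagonal_iff]
  intro i
  exact_mod_cast hf i

lemma isU_eig {A : Matrix n n ℂ} (hA : A.IsHermitian) :
    IsU (hA.eigenvectorUnitary : Matrix n n ℂ) := by
  constructor
  · exact Unitary.coe_star_mul_self hA.eigenvectorUnitary
  · exact Unitary.coe_mul_star_self hA.eigenvectorUnitary

lemma eig_eq {A : Matrix n n ℂ} (hA : A.IsHermitian) :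
    A = sp (hA.eigenvectorUnitary : Matrix n n ℂ) hA.eigenvalues := by
  conv_lhs => rw [hA.spectral_theorem]
  simp [sp, Unitary.conjStarAlgAut_apply, Function.comp_def, Matrix.star_eq_conjTranspose]

lemma hermCFC_eq {A : Matrix n n ℂ} (hA : A.IsHermitian) (f : ℝ → ℝ) :
    hermCFC f A = sp (hA.eigenvectorUnitary : Matrix n n ℂ) (fun i => f (hA.eigenvalues i)) := by
  unfold hermCFC
  rw [dif_pos hA]
  rfl

lemma exists_spec {A : Matrix n n ℂ} (hA : A.PosSemidef) :
    ∃ (U : Matrix n n ℂ) (s : n → ℝ), IsU U ∧ (∀ i, 0 ≤ s i) ∧ A = sp U s ∧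
      ∀ f : ℝ → ℝ, hermCFC f A = sp U (fun i => f (s i)) :=
  ⟨_, _, isU_eig hA.1, hA.eigenvalues_nonneg, eig_eq hA.1, hermCFC_eq hA.1⟩

/-- overlap coefficients -/
def ov (U V : Matrix n n ℂ) (i j : n) : ℝ := Complex.normSq ((Uᴴ * V) i j)

lemma ov_nonneg (U V : Matrix n n ℂ) (i j : n) : 0 ≤ ov U V i j := Complex.normSq_nonneg _

lemma diag_entry (U V : Matrix n n ℂ) (r : n → ℝ) (i : n) :
    (Uᴴ * sp V r * U) i i = ((∑ j, ov U V i j * r j : ℝ) : ℂ) := by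
  have h : Uᴴ * sp V r * U = (Uᴴ * V) * Matrix.diagonal (fun i => (r i : ℂ)) * (Uᴴ * V)ᴴ := by
    unfold sp
    simp only [Matrix.conjTranspose_mul, Matrix.conjTranspose_conjTranspose, Matrix.mul_assoc]
  rw [h, Matrix.mul_apply]
  push_cast
  apply Finset.sum_congr rfl
  intro j _
  rw [Matrix.mul_diagonal, Matrix.conjTranspose_apply]
  unfold ov
  rw [Complex.normSq_eq_conj_mul_self]
  simp only [RCLike.star_def]
  ring

lemma trace_sp (A U : Matrix n n ℂ) (f : n → ℝ) :
    Matrix.trace (A * sp U f) = ∑ i, (Uᴴ * A * U) i i * (f i : ℂ) := by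
  have : Matrix.trace (A * sp U f) =
      Matrix.trace (Uᴴ * A * U * Matrix.diagonal (fun i => (f i : ℂ))) := by
    unfold sp
    rw [← Matrix.mul_assoc, Matrix.trace_mul_comm]
    simp only [Matrix.mul_assoc]
  rw [this, Matrix.trace]
  simp [Matrix.mul_diagonal]

lemma trace_sp_sp (U V : Matrix n n ℂ) (r f : n → ℝ) :
    (Matrix.trace (sp V r * sp U f)).re = ∑ i, ∑ j, ov U V i j * r j * f i := by
  rw [trace_sp]
  simp only [diag_entry, Complex.re_sum]
  apply Finset.sum_congr rfl
  intro i _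
  rw [← Complex.ofReal_mul, Complex.ofReal_re, Finset.sum_mul]

lemma ov_sum_right {U V : Matrix n n ℂ} (hU : IsU U) (hV : IsU V) (i : n) :
    ∑ j, ov U V i j = 1 := by
  have := diag_entry U V (fun _ => 1) i
  rw [sp_one hV, Matrix.mul_one, hU.1, Matrix.one_apply_eq] at this
  simp only [mul_one] at this
  exact_mod_cast this.symm

lemma klein_sums {U V : Matrix n n ℂ} (hU : IsU U) (hV : IsU V) {r s : n → ℝ}
    (hr : ∀ i, 0 ≤ r i) (hs : ∀ i, 0 ≤ s i)
    (h0 : ∀ i, s i = 0 → (Uᴴ * sp V r * U) i i = 0) :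
    ∀ i j, s i = 0 → ov U V i j * r j = 0 := by
  intro i j hi
  have := h0 i hi
  rw [diag_entry] at this
  have h2 : ∑ j, ov U V i j * r j = 0 := by exact_mod_cast this
  rw [Finset.sum_eq_zero_iff_of_nonneg (fun j _ => mul_nonneg (ov_nonneg _ _ _ _) (hr j))] at h2
  exact h2 j (Finset.mem_univ j)

lemma sum_ov_r {U V : Matrix n n ℂ} (hU : IsU U) (hV : IsU V) (r : n → ℝ) :
    ∑ i, ∑ j, ov U V i j * r j = ∑ j, r j := by
  have := trace_sp_sp U V r (fun _ => 1)
  rw [sp_one hU, Matrix.mul_one, sp_trace hV, Complex.ofReal_re] at this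
  simpa using this.symm

lemma sum_ov_s {U V : Matrix n n ℂ} (hU : IsU U) (hV : IsU V) (s : n → ℝ) :
    ∑ i, ∑ j, ov U V i j * s i = ∑ j, s j := by
  simp only [← Finset.sum_mul, ov_sum_right hU hV, one_mul]

lemma vnEnt_spec {ρ V : Matrix n n ℂ} {r : n → ℝ} (hV : IsU V) (h : ρ = sp V r)
    (hf : ∀ f : ℝ → ℝ, hermCFC f ρ = sp V (fun i => f (r i))) :
    vnEnt ρ = - ∑ j, r j * Real.log (r j) := by
  unfold vnEnt matLog
  rw [hf, h, sp_mul hV, sp_trace hV, Complex.ofReal_re]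

/-- Klein's inequality. -/
lemma klein {ρ U : Matrix n n ℂ} (hρ : ρ.PosSemidef) (hU : IsU U) {s : n → ℝ}
    (hs : ∀ i, 0 ≤ s i) (h0 : ∀ i, s i = 0 → (Uᴴ * ρ * U) i i = 0) :
    vnEnt ρ ≤ -(Matrix.trace (ρ * sp U (fun i => Real.log (s i)))).re + ∑ i, s i
      - (Matrix.trace ρ).re := by
  obtain ⟨V, r, hV, hr, hρ', hf⟩ := exists_spec hρ
  rw [vnEnt_spec hV hρ' hf]
  subst hρ'
  have hc := klein_sums hU hV hr hs h0
  rw [trace_sp_sp, sp_trace hV, Complex.ofReal_re]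
  rw [← sum_ov_r hU hV (fun j => r j * Real.log (r j)), ← sum_ov_s hU hV s, ← sum_ov_r hU hV r,
    ← sub_nonneg]
  simp only [← Finset.sum_neg_distrib, ← Finset.sum_add_distrib, ← Finset.sum_sub_distrib]
  apply Finset.sum_nonneg; intro i _
  apply Finset.sum_nonneg; intro j _
  have hcn := ov_nonneg U V i j
  rcases (hs i).eq_or_lt with h | h
  · have := hc i j h.symm
    rw [← h]
    have e : ov U V i j * (r j * Real.log (r j)) = (ov U V i j * r j) * Real.log (r j) := by ring
    rw [e, this]; simp
  rcases (hr j).eq_or_lt with h' | h'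
  · rw [← h']; simp; positivity
  · have := Real.log_le_sub_one_of_pos (div_pos h h')
    rw [Real.log_div h.ne' h'.ne'] at this
    have h3 : r j * (Real.log (s i) - Real.log (r j)) ≤ s i - r j := by
      calc _ ≤ r j * (s i / r j - 1) := by gcongr
        _ = _ := by field_simp
    nlinarith

/-- Converse bound by a chi-square type quantity. -/
lemma klein_upper {ρ U : Matrix n n ℂ} (hρ : ρ.PosSemidef) (hU : IsU U) {s : n → ℝ}
    (hs : ∀ i, 0 ≤ s i) (h0 : ∀ i, s i = 0 → (Uᴴ * ρ * U) i i = 0) :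
    -(Matrix.trace (ρ * sp U (fun i => Real.log (s i)))).re
      - (Matrix.trace (ρ * ρ * sp U (fun i => (s i)⁻¹))).re + (Matrix.trace ρ).re ≤ vnEnt ρ := by
  obtain ⟨V, r, hV, hr, hρ', hf⟩ := exists_spec hρ
  rw [vnEnt_spec hV hρ' hf]
  subst hρ'
  have hc := klein_sums hU hV hr hs h0
  rw [sp_mul hV, trace_sp_sp, trace_sp_sp, sp_trace hV, Complex.ofReal_re]
  rw [← sum_ov_r hU hV (fun j => r j * Real.log (r j)), ← sum_ov_r hU hV r,
    ← sub_nonneg]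
  simp only [← Finset.sum_neg_distrib, ← Finset.sum_add_distrib, ← Finset.sum_sub_distrib]
  apply Finset.sum_nonneg; intro i _
  apply Finset.sum_nonneg; intro j _
  have hcn := ov_nonneg U V i j
  rcases (hs i).eq_or_lt with h | h
  · have := hc i j h.symm
    rw [← h]
    have e : ov U V i j * (r j * Real.log (r j)) = (ov U V i j * r j) * Real.log (r j) := by ring
    rw [e, this]; simp
  rcases (hr j).eq_or_lt with h' | h'
  · rw [← h']; simp
  · have := Real.log_le_sub_one_of_pos (div_pos h' h)
    rw [Real.log_div h'.ne' h.ne'] at this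
    have h3 : r j * (Real.log (r j) - Real.log (s i)) ≤ r j * r j * (s i)⁻¹ - r j := by
      calc _ ≤ r j * (r j / s i - 1) := by gcongr
        _ = _ := by field_simp
    nlinarith

lemma conj_sp {U : Matrix n n ℂ} (hU : IsU U) (r : n → ℝ) (i : n) :
    (Uᴴ * sp U r * U) i i = (r i : ℂ) := by
  have : Uᴴ * sp U r * U = Matrix.diagonal (fun i => (r i : ℂ)) := by
    unfold sp
    calc _ = (Uᴴ * U) * Matrix.diagonal (fun i => (r i : ℂ)) * (Uᴴ * U) := by
          simp only [Matrix.mul_assoc]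
      _ = _ := by rw [hU.1]; simp
  rw [this]; simp

lemma vnEnt_sp {U : Matrix n n ℂ} (hU : IsU U) {r : n → ℝ} (hr : ∀ i, 0 ≤ r i) :
    vnEnt (sp U r) = ∑ i, Real.negMulLog (r i) := by
  have h0 : ∀ i, r i = 0 → (Uᴴ * sp U r * U) i i = 0 := by
    intro i hi; rw [conj_sp hU, hi]; simp
  have h1 := klein (sp_posSemidef U r hr) hU hr h0
  have h2 := klein_upper (sp_posSemidef U r hr) hU hr h0
  rw [sp_mul hU, sp_trace hU, sp_trace hU, Complex.ofReal_re, Complex.ofReal_re] at h1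
  rw [sp_mul hU, sp_mul hU, sp_mul hU, sp_trace hU, sp_trace hU, sp_trace hU, Complex.ofReal_re,
    Complex.ofReal_re, Complex.ofReal_re] at h2
  have e : ∀ i, r i * r i * (r i)⁻¹ = r i := fun i => by
    by_cases h : r i = 0
    · simp [h]
    · field_simp
  simp only [e] at h2
  simp only [Real.negMulLog, neg_mul, Finset.sum_neg_distrib]
  linarith
end helpers

section dpi
variable {n m : Type*} [Fintype n] [DecidableEq n] [Fintype m] [DecidableEq m]

/-- Auxiliary interpolating function. -/
def FF (c : n → n → ℝ) (r s : n → ℝ) (T : ℝ) : ℝ :=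
  ∑ i, ∑ j, c i j * r j * Real.log (s i + T * r j)

lemma FF_cont (c : n → n → ℝ) (r s : n → ℝ) (hr : ∀ i, 0 ≤ r i) (hs : ∀ i, 0 ≤ s i)
    (hc : ∀ i j, s i = 0 → c i j * r j = 0) : ContinuousOn (FF c r s) (Set.Ici 0) := by
  unfold FF
  apply continuousOn_finsetSum; intro i _
  apply continuousOn_finsetSum; intro j _
  rcases (hs i).eq_or_lt with h | h
  · rw [hc i j h.symm]; simp only [zero_mul]; exact continuousOn_const
  · apply ContinuousOn.mul continuousOn_const
    apply ContinuousOn.log (by fun_prop)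
    intro x hx
    have := mul_nonneg hx (hr j)
    exact (by linarith : 0 < s i + x * r j).ne'

lemma FF_deriv (c : n → n → ℝ) (r s : n → ℝ) (hr : ∀ i, 0 ≤ r i) (hs : ∀ i, 0 ≤ s i)
    {T : ℝ} (hT : 0 < T) :
    HasDerivAt (FF c r s) (∑ i, ∑ j, c i j * (r j ^ 2 / (s i + T * r j))) T := by
  unfold FF
  apply HasDerivAt.fun_sum; intro i _
  apply HasDerivAt.fun_sum; intro j _
  rcases (hr j).eq_or_lt with h | h
  · rw [← h]; simpa using hasDerivAt_const T (0 : ℝ)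
  · have hp : s i + T * r j ≠ 0 := (add_pos_of_nonneg_of_pos (hs i) (mul_pos hT h)).ne'
    have h1 : HasDerivAt (fun T : ℝ => s i + T * r j) (1 * r j) T :=
      ((hasDerivAt_id T).mul_const (r j)).const_add (s i)
    have := (h1.log hp).const_mul (c i j * r j)
    exact this.congr_deriv (by ring)

lemma FF_lim (c : n → n → ℝ) (r s : n → ℝ) (hr : ∀ i, 0 ≤ r i) (hs : ∀ i, 0 ≤ s i) :
    Filter.Tendsto (fun T => FF c r s T - (∑ i, ∑ j, c i j * r j) * Real.log T) Filter.atTop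
      (nhds (∑ i, ∑ j, c i j * (r j * Real.log (r j)))) := by
  unfold FF
  simp only [Finset.sum_mul, ← Finset.sum_sub_distrib]
  apply tendsto_finsetSum; intro i _
  apply tendsto_finsetSum; intro j _
  rcases (hr j).eq_or_lt with h | h
  · rw [← h]; simp
  · have h1 : Filter.Tendsto (fun T : ℝ => s i * T⁻¹ + r j) Filter.atTop (nhds (s i * 0 + r j)) :=
      (tendsto_inv_atTop_zero.const_mul (s i)).add_const (r j)
    rw [mul_zero, zero_add] at h1
    have h2 := (h1.log h.ne').const_mul (c i j * r j)
    rw [mul_assoc] at h2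
    refine h2.congr' ?_
    filter_upwards [Filter.eventually_gt_atTop (0 : ℝ)] with T hT
    have hp : 0 < s i + T * r j := add_pos_of_nonneg_of_pos (hs i) (mul_pos hT h)
    rw [← mul_sub, ← Real.log_div hp.ne' hT.ne']
    congr 2
    field_simp

lemma trace_conj_mul (A B : Matrix n n ℂ) :
    Matrix.trace (Aᴴ * B) = ∑ i, ∑ j, star (A i j) * B i j := by
  rw [Matrix.trace, Finset.sum_comm]
  simp [Matrix.mul_apply]

lemma var_eq {U V : Matrix n n ℂ} (hU : IsU U) (hV : IsU V) (r s : n → ℝ) (t : ℝ)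
    (Z : Matrix n n ℂ) :
    2 * (Matrix.trace ((U * Z * Vᴴ)ᴴ * sp V r)).re
      - (Matrix.trace (sp U s * ((U * Z * Vᴴ) * (U * Z * Vᴴ)ᴴ))).re
      - t * (Matrix.trace (sp V r * ((U * Z * Vᴴ)ᴴ * (U * Z * Vᴴ)))).re
    = ∑ i, ∑ j, (2 * r j * (star (Z i j) * (Uᴴ * V) i j).re
        - (s i + t * r j) * Complex.normSq (Z i j)) := by
  have e1 : Matrix.trace ((U * Z * Vᴴ)ᴴ * sp V r) =
      Matrix.trace (Zᴴ * ((Uᴴ * V) * Matrix.diagonal (fun i => (r i : ℂ)))) := by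
    unfold sp
    simp only [Matrix.conjTranspose_mul, Matrix.conjTranspose_conjTranspose]
    calc _ = Matrix.trace (V * (Zᴴ * Uᴴ * V * Matrix.diagonal (fun i => (r i : ℂ)) * Vᴴ)) := by
          simp only [Matrix.mul_assoc]
      _ = Matrix.trace (Zᴴ * Uᴴ * V * Matrix.diagonal (fun i => (r i : ℂ)) * (Vᴴ * V)) := by
          rw [Matrix.trace_mul_comm]; simp only [Matrix.mul_assoc]
      _ = _ := by rw [hV.1]; simp only [Matrix.mul_assoc, Matrix.mul_one]
  have e2 : Matrix.trace (sp U s * ((U * Z * Vᴴ) * (U * Z * Vᴴ)ᴴ)) =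
      Matrix.trace (Zᴴ * (Matrix.diagonal (fun i => (s i : ℂ)) * Z)) := by
    unfold sp
    simp only [Matrix.conjTranspose_mul, Matrix.conjTranspose_conjTranspose]
    calc _ = Matrix.trace (U * (Matrix.diagonal (fun i => (s i : ℂ)) * (Uᴴ * U) * Z * (Vᴴ * V) *
            Zᴴ * Uᴴ)) := by simp only [Matrix.mul_assoc]
      _ = Matrix.trace (Matrix.diagonal (fun i => (s i : ℂ)) * (Uᴴ * U) * Z * (Vᴴ * V) *
            Zᴴ * (Uᴴ * U)) := by rw [Matrix.trace_mul_comm]; simp only [Matrix.mul_assoc]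
      _ = Matrix.trace (Matrix.diagonal (fun i => (s i : ℂ)) * Z * Zᴴ) := by
          rw [hV.1, hU.1]; simp only [Matrix.mul_one]
      _ = _ := by rw [Matrix.trace_mul_comm]
  have e3 : Matrix.trace (sp V r * ((U * Z * Vᴴ)ᴴ * (U * Z * Vᴴ))) =
      Matrix.trace (Zᴴ * (Z * Matrix.diagonal (fun i => (r i : ℂ)))) := by
    unfold sp
    simp only [Matrix.conjTranspose_mul, Matrix.conjTranspose_conjTranspose]
    calc _ = Matrix.trace (V * (Matrix.diagonal (fun i => (r i : ℂ)) * (Vᴴ * V) * Zᴴ * (Uᴴ * U) *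
            Z * Vᴴ)) := by simp only [Matrix.mul_assoc]
      _ = Matrix.trace (Matrix.diagonal (fun i => (r i : ℂ)) * (Vᴴ * V) * Zᴴ * (Uᴴ * U) *
            Z * (Vᴴ * V)) := by rw [Matrix.trace_mul_comm]; simp only [Matrix.mul_assoc]
      _ = Matrix.trace (Matrix.diagonal (fun i => (r i : ℂ)) * (Zᴴ * Z)) := by
          rw [hV.1, hU.1]; simp only [Matrix.mul_one, Matrix.mul_assoc]
      _ = _ := by rw [Matrix.trace_mul_comm]; simp only [Matrix.mul_assoc]
  rw [e1, e2, e3, trace_conj_mul, trace_conj_mul, trace_conj_mul]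
  simp only [Complex.re_sum, Finset.mul_sum, ← Finset.sum_sub_distrib]
  apply Finset.sum_congr rfl; intro i _
  apply Finset.sum_congr rfl; intro j _
  rw [Matrix.mul_diagonal, Matrix.diagonal_mul, Matrix.mul_diagonal]
  generalize (Uᴴ * V) i j = w
  generalize Z i j = z
  simp [Complex.normSq_apply]
  ring

lemma var_le {U V : Matrix n n ℂ} (hU : IsU U) (hV : IsU V) (r s : n → ℝ)
    (hr : ∀ i, 0 ≤ r i) (hs : ∀ i, 0 ≤ s i) {t : ℝ} (ht : 0 < t) (X : Matrix n n ℂ) :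
    2 * (Matrix.trace (Xᴴ * sp V r)).re
      - (Matrix.trace (sp U s * (X * Xᴴ))).re
      - t * (Matrix.trace (sp V r * (Xᴴ * X))).re
    ≤ ∑ i, ∑ j, ov U V i j * (r j ^ 2 / (s i + t * r j)) := by
  have hX : X = U * (Uᴴ * X * V) * Vᴴ := by
    calc X = (U * Uᴴ) * X * (V * Vᴴ) := by rw [hU.2, hV.2]; simp
      _ = _ := by simp only [Matrix.mul_assoc]
  rw [hX, var_eq hU hV]
  apply Finset.sum_le_sum; intro i _
  apply Finset.sum_le_sum; intro j _
  unfold ov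
  generalize (Uᴴ * V) i j = w
  generalize (Uᴴ * X * V) i j = z
  have h0 := mul_nonneg ht.le (hr j)
  rcases (hr j).eq_or_lt with h | h
  · rw [← h]; simp
    exact mul_nonneg (hs i) (Complex.normSq_nonneg _)
  · have hp : 0 < s i + t * r j := add_pos_of_nonneg_of_pos (hs i) (mul_pos ht h)
    generalize s i + t * r j = q at *
    rw [← mul_div_assoc, le_div_iff₀ hp]
    simp [Complex.normSq_apply]
    nlinarith [sq_nonneg (w.re * r j - q * z.re), sq_nonneg (w.im * r j - q * z.im)]

lemma var_attained {U V : Matrix n n ℂ} (hU : IsU U) (hV : IsU V) (r s : n → ℝ)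
    (hr : ∀ i, 0 ≤ r i) (hs : ∀ i, 0 ≤ s i) {t : ℝ} (ht : 0 < t) : ∃ X : Matrix n n ℂ,
    2 * (Matrix.trace (Xᴴ * sp V r)).re
      - (Matrix.trace (sp U s * (X * Xᴴ))).re
      - t * (Matrix.trace (sp V r * (Xᴴ * X))).re
    = ∑ i, ∑ j, ov U V i j * (r j ^ 2 / (s i + t * r j)) := by
  refine ⟨U * (Matrix.of fun i j => ((r j / (s i + t * r j) : ℝ) : ℂ) * (Uᴴ * V) i j) * Vᴴ, ?_⟩
  rw [var_eq hU hV]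
  apply Finset.sum_congr rfl; intro i _
  apply Finset.sum_congr rfl; intro j _
  unfold ov
  rw [Matrix.of_apply]
  generalize (Uᴴ * V) i j = w
  rcases (hr j).eq_or_lt with h | h
  · rw [← h]; simp
  · have hp : 0 < s i + t * r j := add_pos_of_nonneg_of_pos (hs i) (mul_pos ht h)
    generalize s i + t * r j = q at *
    rw [Complex.normSq_mul, Complex.normSq_ofReal]
    simp only [RCLike.star_def, map_mul, Complex.conj_ofReal, mul_assoc, Complex.re_ofReal_mul]
    rw [← Complex.normSq_eq_conj_mul_self, Complex.ofReal_re]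
    field_simp
    ring

variable {I : Type} [Fintype I]

/-- Channel. -/
def ch (K : I → Matrix m n ℂ) (X : Matrix n n ℂ) : Matrix m m ℂ := ∑ i, K i * X * (K i)ᴴ
/-- Adjoint channel. -/
def ad (K : I → Matrix m n ℂ) (Y : Matrix m m ℂ) : Matrix n n ℂ := ∑ i, (K i)ᴴ * Y * K i

lemma ch_ad (K : I → Matrix m n ℂ) (X : Matrix n n ℂ) (Y : Matrix m m ℂ) :
    Matrix.trace (ch K X * Y) = Matrix.trace (X * ad K Y) := by
  unfold ch ad
  rw [Matrix.sum_mul, Matrix.mul_sum, Matrix.trace_sum, Matrix.trace_sum]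
  apply Finset.sum_congr rfl; intro i _
  calc _ = Matrix.trace (K i * (X * (K i)ᴴ * Y)) := by simp only [Matrix.mul_assoc]
    _ = _ := by rw [Matrix.trace_mul_comm]; simp only [Matrix.mul_assoc]

lemma ad_conj (K : I → Matrix m n ℂ) (Y : Matrix m m ℂ) : (ad K Y)ᴴ = ad K Yᴴ := by
  unfold ad
  rw [Matrix.conjTranspose_sum]
  simp [Matrix.mul_assoc]

lemma ad_one (K : I → Matrix m n ℂ) (hK : ∑ i, (K i)ᴴ * K i = 1) : ad K 1 = 1 := by
  simpa [ad] using hK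

lemma ch_add (K : I → Matrix m n ℂ) (X Y : Matrix n n ℂ) : ch K (X + Y) = ch K X + ch K Y := by
  simp [ch, Matrix.mul_add, Matrix.add_mul, Finset.sum_add_distrib]

lemma ch_smul (K : I → Matrix m n ℂ) (c : ℂ) (X : Matrix n n ℂ) :
    ch K (c • X) = c • ch K X := by
  simp [ch, Finset.smul_sum]

lemma ch_psd (K : I → Matrix m n ℂ) {X : Matrix n n ℂ} (hX : X.PosSemidef) :
    (ch K X).PosSemidef := by
  unfold ch
  exact Matrix.posSemidef_sum _ fun i _ => hX.mul_mul_conjTranspose_same (K i)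

lemma ch_trace (K : I → Matrix m n ℂ) (hK : ∑ i, (K i)ᴴ * K i = 1) (X : Matrix n n ℂ) :
    Matrix.trace (ch K X) = Matrix.trace X := by
  have := ch_ad K X 1
  rwa [ad_one K hK, Matrix.mul_one, Matrix.mul_one] at this

lemma kadison (K : I → Matrix m n ℂ) (hK : ∑ i, (K i)ᴴ * K i = 1) {σ : Matrix n n ℂ}
    (hσ : σ.PosSemidef) (Y : Matrix m m ℂ) :
    (Matrix.trace (σ * (ad K Y * (ad K Y)ᴴ))).re ≤ (Matrix.trace (ch K σ * (Y * Yᴴ))).re := by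
  rw [ch_ad]
  set A := ad K Y with hA
  have key : ad K (Y * Yᴴ) - A * Aᴴ =
      ∑ i, ((K i)ᴴ * Y - A * (K i)ᴴ) * ((K i)ᴴ * Y - A * (K i)ᴴ)ᴴ := by
    have e : ∀ i, ((K i)ᴴ * Y - A * (K i)ᴴ) * ((K i)ᴴ * Y - A * (K i)ᴴ)ᴴ =
        (K i)ᴴ * (Y * Yᴴ) * K i - ((K i)ᴴ * Y * K i) * Aᴴ - A * ((K i)ᴴ * Yᴴ * K i)
          + A * ((K i)ᴴ * K i) * Aᴴ := by
      intro i
      simp only [Matrix.conjTranspose_sub, Matrix.conjTranspose_mul,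
        Matrix.conjTranspose_conjTranspose, Matrix.sub_mul, Matrix.mul_sub, Matrix.mul_assoc]
      abel
    simp only [e, Finset.sum_add_distrib, Finset.sum_sub_distrib]
    rw [← Matrix.sum_mul, ← Matrix.mul_sum, ← Matrix.sum_mul, ← Matrix.mul_sum, hK]
    change _ = ad K (Y * Yᴴ) - ad K Y * Aᴴ - A * ad K Yᴴ + A * 1 * Aᴴ
    rw [← ad_conj, ← hA, Matrix.mul_one]
    abel
  rw [← sub_nonneg, ← Complex.sub_re, ← Matrix.trace_sub, ← Matrix.mul_sub, key, Matrix.mul_sum,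
    Matrix.trace_sum, Complex.re_sum]
  apply Finset.sum_nonneg; intro i _
  generalize ((K i)ᴴ * Y - A * (K i)ᴴ) = B
  rw [← Matrix.mul_assoc, Matrix.trace_mul_comm, ← Matrix.mul_assoc]
  have := (hσ.conjTranspose_mul_mul_same B).trace_nonneg
  exact (Complex.le_def.1 this).1

lemma diag_zero_of_ker {ρ σ U : Matrix n n ℂ} {s : n → ℝ} (hU : IsU U) (hσ : σ = sp U s)
    (h : ∀ w, σ *ᵥ w = 0 → ρ *ᵥ w = 0) (i : n) (hi : s i = 0) : (Uᴴ * ρ * U) i i = 0 := by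
  have h1 : σ *ᵥ (U *ᵥ Pi.single i 1) = 0 := by
    rw [hσ, Matrix.mulVec_mulVec]
    unfold sp
    rw [Matrix.mul_assoc, hU.1, Matrix.mul_one, ← Matrix.mulVec_mulVec]
    have : Matrix.diagonal (fun i => (s i : ℂ)) *ᵥ Pi.single i 1 = 0 := by
      ext k
      rw [Matrix.mulVec_diagonal]
      by_cases hk : k = i
      · subst hk; simp [hi]
      · simp [hk]
    rw [this, Matrix.mulVec_zero]
  have h2 := h _ h1
  have h3 : (Uᴴ * ρ * U) *ᵥ Pi.single i 1 = 0 := by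
    rw [← Matrix.mulVec_mulVec, ← Matrix.mulVec_mulVec, h2, Matrix.mulVec_zero]
  have h4 := congrFun h3 i
  simpa using h4

lemma ker_ch (K : I → Matrix m n ℂ) {φ σ : Matrix n n ℂ} (hφ : φ.PosSemidef)
    (h : ∀ w, φ *ᵥ w = 0 → σ *ᵥ w = 0) : ∀ w, ch K φ *ᵥ w = 0 → ch K σ *ᵥ w = 0 := by
  intro w hw
  have h1 : ∑ i, star ((K i)ᴴ *ᵥ w) ⬝ᵥ (φ *ᵥ ((K i)ᴴ *ᵥ w)) = 0 := by
    have : star w ⬝ᵥ (ch K φ *ᵥ w) = 0 := by rw [hw]; simp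
    rw [← this]
    unfold ch
    rw [Matrix.sum_mulVec, dotProduct_sum]
    apply Finset.sum_congr rfl; intro i _
    rw [Matrix.star_mulVec, Matrix.conjTranspose_conjTranspose, ← Matrix.mulVec_mulVec,
      ← Matrix.mulVec_mulVec, ← Matrix.dotProduct_mulVec]
  rw [Finset.sum_eq_zero_iff_of_nonneg (fun i _ => hφ.dotProduct_mulVec_nonneg _)] at h1
  unfold ch
  rw [Matrix.sum_mulVec]
  apply Finset.sum_eq_zero; intro i hi
  rw [← Matrix.mulVec_mulVec, ← Matrix.mulVec_mulVec,
    h _ ((hφ.dotProduct_mulVec_zero_iff _).1 (h1 i hi)), Matrix.mulVec_zero]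

/-- Data processing inequality for the relative entropy. -/
lemma dpi (K : I → Matrix m n ℂ) (hK : ∑ i, (K i)ᴴ * K i = 1) {ρ σ : Matrix n n ℂ}
    (hρ : ρ.PosSemidef) (hσ : σ.PosSemidef) (hker : ∀ w, σ *ᵥ w = 0 → ρ *ᵥ w = 0) :
    (Matrix.trace (ρ * matLog σ)).re - (Matrix.trace (ch K ρ * matLog (ch K σ))).re
      ≤ vnEnt (ch K ρ) - vnEnt ρ := by
  have hker' := ker_ch K hσ hker
  have hρ2 := ch_psd K hρ
  have hσ2 := ch_psd K hσ
  obtain ⟨V, r, hV, hr, eρ, fρ⟩ := exists_spec hρ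
  obtain ⟨U, s, hU, hs, eσ, fσ⟩ := exists_spec hσ
  obtain ⟨V', r', hV', hr', eρ', fρ'⟩ := exists_spec hρ2
  obtain ⟨U', s', hU', hs', eσ', fσ'⟩ := exists_spec hσ2
  have h0 := klein_sums hU hV hr hs (eρ ▸ diag_zero_of_ker hU eσ hker)
  have h0' := klein_sums hU' hV' hr' hs' (eρ' ▸ diag_zero_of_ker hU' eσ' hker')
  rw [vnEnt_spec hV eρ fρ, vnEnt_spec hV' eρ' fρ']
  unfold matLog
  rw [fσ, fσ']
  have hmono : MonotoneOn (fun T => FF (ov U V) r s T - FF (ov U' V') r' s' T) (Set.Ici 0) := by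
    apply monotoneOn_of_deriv_nonneg (convex_Ici 0)
    · exact (FF_cont _ r s hr hs h0).sub (FF_cont _ r' s' hr' hs' h0')
    · intro T hT
      rw [interior_Ici] at hT
      exact ((FF_deriv _ r s hr hs hT).sub
        (FF_deriv _ r' s' hr' hs' hT)).differentiableAt.differentiableWithinAt
    · intro T hT
      rw [interior_Ici] at hT
      have hT' : 0 < T := hT
      have := ((FF_deriv (ov U V) r s hr hs hT').sub (FF_deriv (ov U' V') r' s' hr' hs' hT')).deriv
      change 0 ≤ deriv (FF (ov U V) r s - FF (ov U' V') r' s') T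
      rw [this, sub_nonneg]
      obtain ⟨Y, hY⟩ := var_attained hU' hV' r' s' hr' hs' hT'
      rw [← hY]
      refine le_trans ?_ (var_le hU hV r s hr hs hT' (ad K Y))
      rw [← eρ, ← eσ, ← eρ', ← eσ']
      have k1 := kadison K hK hσ Y
      have k2 := kadison K hK hρ Yᴴ
      rw [← ad_conj, Matrix.conjTranspose_conjTranspose, Matrix.conjTranspose_conjTranspose] at k2
      have k3 : Matrix.trace (Yᴴ * ch K ρ) = Matrix.trace ((ad K Y)ᴴ * ρ) := by
        rw [Matrix.trace_mul_comm, ch_ad, ad_conj, Matrix.trace_mul_comm]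
      rw [k3]
      nlinarith
  have htr : ∑ i, ∑ j, ov U V i j * r j = ∑ i, ∑ j, ov U' V' i j * r' j := by
    rw [sum_ov_r hU hV, sum_ov_r hU' hV']
    have := ch_trace K hK ρ
    rw [eρ', eρ, sp_trace hV, sp_trace hV'] at this
    exact_mod_cast this.symm
  have hlim := (FF_lim (ov U V) r s hr hs).sub (FF_lim (ov U' V') r' s' hr' hs')
  have hfin := ge_of_tendsto hlim (b := FF (ov U V) r s 0 - FF (ov U' V') r' s' 0) (by
    filter_upwards [Filter.eventually_ge_atTop (0 : ℝ)] with T hT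
    have := hmono (Set.mem_Ici.2 le_rfl) (Set.mem_Ici.2 hT) hT
    simp only at this
    rw [htr]
    linarith)
  rw [sum_ov_r hU hV, sum_ov_r hU' hV'] at hfin
  have z1 : (Matrix.trace (ρ * sp U (fun i => Real.log (s i)))).re = FF (ov U V) r s 0 := by
    rw [eρ, trace_sp_sp]; simp [FF]
  have z2 : (Matrix.trace (ch K ρ * sp U' (fun i => Real.log (s' i)))).re =
      FF (ov U' V') r' s' 0 := by
    rw [eρ', trace_sp_sp]; simp [FF]
  rw [z1, z2]
  linarith
end dpi

section opt
variable {n m : Type*} [Fintype n] [DecidableEq n] [Fintype m] [DecidableEq m]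
variable {I : Type} [Fintype I]

lemma small_t {x C : ℝ} (h : ∀ t : ℝ, 0 < t → t < 1 → x ≤ t * C) : x ≤ 0 := by
  by_contra hx
  push Not at hx
  have hC : 0 < |C| + x + 1 := by positivity
  have h1 := h (x / (|C| + x + 1)) (by positivity) (by
    rw [div_lt_one hC]; linarith [abs_nonneg C])
  have h2 : x / (|C| + x + 1) * C ≤ x / (|C| + x + 1) * |C| := by gcongr; exact le_abs_self C
  have h3 : x / (|C| + x + 1) * |C| < x := by
    rw [div_mul_eq_mul_div, div_lt_iff₀ hC]
    nlinarith [abs_nonneg C]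
  linarith

lemma log_t {p C : ℝ} (h : ∀ t : ℝ, 0 < t → t < 1 → p * (-Real.log t) ≤ C) : p ≤ 0 := by
  by_contra hp
  push Not at hp
  have h1 := h (Real.exp (-((|C| + 1) / p))) (Real.exp_pos _) (by
    rw [Real.exp_lt_one_iff]
    have : 0 < (|C| + 1) / p := by positivity
    linarith)
  rw [Real.log_exp, neg_neg, mul_div_cancel₀ _ hp.ne'] at h1
  linarith [le_abs_self C]

lemma mix_density {φ σ : Matrix n n ℂ} (hφ : IsDensity φ) (hσ : IsDensity σ) {t : ℝ}
    (ht : 0 < t) (ht1 : t < 1) :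
    IsDensity (((1 - t : ℝ) : ℂ) • φ + (t : ℂ) • σ) := by
  constructor
  · apply Matrix.PosSemidef.add
    · exact hφ.1.smul (by exact_mod_cast (by linarith : (0 : ℝ) ≤ 1 - t))
    · exact hσ.1.smul (by exact_mod_cast ht.le)
  · rw [Matrix.trace_add, Matrix.trace_smul, Matrix.trace_smul, hφ.2, hσ.2]
    simp

lemma mix_trace (φ σ X : Matrix n n ℂ) (t : ℝ) :
    (Matrix.trace ((((1 - t : ℝ) : ℂ) • φ + (t : ℂ) • σ) * X)).re =
      (1 - t) * (Matrix.trace (φ * X)).re + t * (Matrix.trace (σ * X)).re := by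
  rw [Matrix.add_mul, Matrix.smul_mul, Matrix.smul_mul, Matrix.trace_add, Matrix.trace_smul,
    Matrix.trace_smul, smul_eq_mul, smul_eq_mul, Complex.add_re, Complex.re_ofReal_mul,
    Complex.re_ofReal_mul]

lemma ch_mix (K : I → Matrix m n ℂ) (φ σ : Matrix n n ℂ) (t : ℝ) :
    ch K (((1 - t : ℝ) : ℂ) • φ + (t : ℂ) • σ) =
      ((1 - t : ℝ) : ℂ) • ch K φ + (t : ℂ) • ch K σ := by
  rw [ch_add, ch_smul, ch_smul]

lemma ch_density (K : I → Matrix m n ℂ) (hK : ∑ i, (K i)ᴴ * K i = 1) {σ : Matrix n n ℂ}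
    (hσ : IsDensity σ) : IsDensity (ch K σ) :=
  ⟨ch_psd K hσ.1, by rw [ch_trace K hK, hσ.2]⟩

lemma kill_p (K : I → Matrix m n ℂ) (hK : ∑ i, (K i)ᴴ * K i = 1) {φ : Matrix n n ℂ}
    (hφ : IsDensity φ)
    (hmax : ∀ σ, IsDensity σ → vnEnt σ - vnEnt (ch K σ) ≤ vnEnt φ - vnEnt (ch K φ))
    {U : Matrix n n ℂ} {s : n → ℝ} (hU : IsU U) (hs : ∀ i, 0 ≤ s i) (e : φ = sp U s)
    {U' : Matrix m m ℂ} {s' : m → ℝ} (hU' : IsU U') (hs' : ∀ i, 0 ≤ s' i)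
    (e' : ch K φ = sp U' s') (f' : matLog (ch K φ) = sp U' (fun i => Real.log (s' i)))
    (j : n) (hj : s j = 0) :
    (Matrix.trace (ch K (sp U (Pi.single j 1)) *
      sp U' (fun i => if s' i = 0 then 0 else 1))).re ≤ 0 := by
  set δ : n → ℝ := Pi.single j 1 with hδ
  have hδ0 : ∀ i, 0 ≤ δ i := by
    intro i; by_cases h : i = j
    · subst h; simp [hδ]
    · simp [hδ, h]
  set ψ := sp U δ with hψ
  have dψ : IsDensity ψ := ⟨sp_posSemidef U δ hδ0, by rw [hψ, sp_trace hU]; simp [hδ]⟩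
  set q : m → ℝ := fun i => if s' i = 0 then 1 else 0 with hq
  set p := (Matrix.trace (ch K ψ * sp U' (fun i => if s' i = 0 then 0 else 1))).re with hp
  have hpq : (Matrix.trace (ch K ψ * sp U' q)).re = 1 - p := by
    have h1 : sp U' q + sp U' (fun i => if s' i = 0 then 0 else 1) = 1 := by
      rw [sp_add, ← sp_one hU']
      congr 1; ext i; by_cases h : s' i = 0 <;> simp [hq, h]
    rw [hp, eq_sub_iff_add_eq, ← Complex.add_re, ← Matrix.trace_add, ← Matrix.mul_add, h1,
      Matrix.mul_one, ch_trace K hK, dψ.2]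
    simp
  have hφq : (Matrix.trace (ch K φ * sp U' q)).re = 0 := by
    rw [e', sp_mul hU']
    have : (fun i => s' i * q i) = fun _ => 0 := by
      ext i; by_cases h : s' i = 0 <;> simp [hq, h]
    rw [this, sp_zero]; simp
  have hφL : (Matrix.trace (ch K φ * sp U' (fun i => Real.log (s' i)))).re = - vnEnt (ch K φ) := by
    unfold vnEnt; rw [f', neg_neg]
  set b := (Matrix.trace (ch K ψ * sp U' (fun i => Real.log (s' i)))).re with hb
  have hsum : ∑ i, s' i = 1 := by
    have := (ch_density K hK hφ).2
    rw [e', sp_trace hU'] at this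
    exact_mod_cast this
  apply log_t (C := vnEnt φ - vnEnt (ch K φ) - b + ∑ i, q i)
  intro t ht ht1
  have hm := hmax _ (mix_density hφ dψ ht ht1)
  have hin : (1 - t) * vnEnt φ + Real.negMulLog t ≤
      vnEnt (((1 - t : ℝ) : ℂ) • φ + (t : ℂ) • ψ) := by
    rw [e, hψ, sp_smul, sp_smul, sp_add, vnEnt_sp hU hs, vnEnt_sp hU]
    · have h2 : Real.negMulLog t = ∑ i, δ i * Real.negMulLog t := by
        rw [← Finset.sum_mul]; simp [hδ]
      rw [h2, Finset.mul_sum, ← Finset.sum_add_distrib]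
      apply Finset.sum_le_sum; intro i _
      by_cases h : i = j
      · subst h; simp [hδ, hj]
      · have : δ i = 0 := by simp [hδ, h]
        rw [this]
        have h4 : 0 ≤ s i * Real.negMulLog (1 - t) :=
          mul_nonneg (hs i) (Real.negMulLog_nonneg (by linarith) (by linarith))
        simp only [mul_zero, zero_mul, add_zero]
        rw [Real.negMulLog_mul]
        linarith
    · intro i
      have := mul_nonneg (by linarith : 0 ≤ 1 - t) (hs i)
      have := mul_nonneg ht.le (hδ0 i)
      linarith
  have hout := klein (ρ := ch K (((1 - t : ℝ) : ℂ) • φ + (t : ℂ) • ψ)) (U := U')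
    (s := fun i => s' i + t * q i)
    (ch_density K hK (mix_density hφ dψ ht ht1)).1 hU' (by
      intro i
      have : 0 ≤ q i := by by_cases h : s' i = 0 <;> simp [hq, h]
      have := mul_nonneg ht.le this
      linarith [hs' i]) (by
      intro i hi
      exfalso
      by_cases h : s' i = 0
      · simp [hq, h] at hi; linarith
      · simp [hq, h] at hi)
  have hlog : sp U' (fun i => Real.log (s' i + t * q i)) =
      sp U' (fun i => Real.log (s' i)) + ((Real.log t : ℝ) : ℂ) • sp U' q := by
    rw [sp_smul, sp_add]
    congr 1; ext i; by_cases h : s' i = 0 <;> simp [hq, h]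
  rw [(ch_density K hK (mix_density hφ dψ ht ht1)).2, hlog, ch_mix, Matrix.mul_add,
    Matrix.trace_add, Complex.add_re, Matrix.mul_smul, Matrix.trace_smul, smul_eq_mul,
    Complex.re_ofReal_mul, mix_trace, mix_trace, hφL, hφq, hpq, ← hb, Finset.sum_add_distrib,
    hsum, ← Finset.mul_sum, Complex.one_re] at hout
  rw [ch_mix] at hm
  rw [Real.negMulLog] at hin
  have hfin : t * (p * (-Real.log t)) ≤ t * (vnEnt φ - vnEnt (ch K φ) - b + ∑ i, q i) := by
    linarith
  exact le_of_mul_le_mul_left hfin ht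

lemma kill (K : I → Matrix m n ℂ) {U : Matrix n n ℂ} (hU : IsU U)
    {U' : Matrix m m ℂ} {s' : m → ℝ} (hU' : IsU U') (j : n)
    (h : (Matrix.trace (ch K (sp U (Pi.single j 1)) *
      sp U' (fun i => if s' i = 0 then 0 else 1))).re ≤ 0) (i : I) :
    sp U' (fun i => if s' i = 0 then 0 else 1) * K i * sp U (Pi.single j 1) = 0 := by
  set R := sp U' (fun i => if s' i = 0 then 0 else 1) with hR
  set ψ := sp U (Pi.single j 1) with hψ
  have hRR : R * R = R := by
    rw [hR, sp_mul hU']; congr 1; ext i; by_cases h : s' i = 0 <;> simp [h]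
  have hψψ : ψ * ψ = ψ := by
    rw [hψ, sp_mul hU]; congr 1; ext i; by_cases h : i = j
    · subst h; simp
    · simp [h]
  have hRh : Rᴴ = R := sp_herm _ _
  have hψh : ψᴴ = ψ := sp_herm _ _
  have e : Matrix.trace (ch K ψ * R) = ∑ i, Matrix.trace ((R * K i * ψ) * (R * K i * ψ)ᴴ) := by
    unfold ch
    rw [Matrix.sum_mul, Matrix.trace_sum]
    apply Finset.sum_congr rfl; intro i _
    simp only [Matrix.conjTranspose_mul, hRh, hψh]
    conv_lhs => rw [← hψψ, ← hRR]
    rw [← Matrix.mul_assoc, Matrix.trace_mul_comm]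
    simp only [Matrix.mul_assoc]
  rw [e, Complex.re_sum] at h
  have hnn : ∀ i, 0 ≤ Matrix.trace ((R * K i * ψ) * (R * K i * ψ)ᴴ) := fun i =>
    (Matrix.posSemidef_self_mul_conjTranspose (R * K i * ψ)).trace_nonneg
  have hnn' : ∀ i ∈ Finset.univ, 0 ≤ (Matrix.trace ((R * K i * ψ) * (R * K i * ψ)ᴴ)).re :=
    fun i _ => (Complex.le_def.1 (hnn i)).1
  have h0 := le_antisymm h (Finset.sum_nonneg hnn')
  rw [Finset.sum_eq_zero_iff_of_nonneg hnn'] at h0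
  have h1 : Matrix.trace ((R * K i * ψ) * (R * K i * ψ)ᴴ) = 0 := by
    apply Complex.ext
    · exact h0 i (Finset.mem_univ i)
    · exact (Complex.le_def.1 (hnn i)).2.symm
  exact Matrix.trace_mul_conjTranspose_self_eq_zero_iff.1 h1

lemma obj_eq (K : I → Matrix m n ℂ) (φ : Matrix n n ℂ) :
    vnEnt φ - vnEnt (ch K φ) =
      -(Matrix.trace (φ * (matLog φ - ad K (matLog (ch K φ))))).re := by
  unfold vnEnt
  rw [Matrix.mul_sub, Matrix.trace_sub, ← ch_ad, Complex.sub_re]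
  ring

lemma first_order (K : I → Matrix m n ℂ) (hK : ∑ i, (K i)ᴴ * K i = 1) {φ : Matrix n n ℂ}
    (hφ : IsDensity φ)
    (hmax : ∀ σ, IsDensity σ → vnEnt σ - vnEnt (ch K σ) ≤ vnEnt φ - vnEnt (ch K φ))
    {U : Matrix n n ℂ} {s : n → ℝ} (hU : IsU U) (hs : ∀ i, 0 ≤ s i) (e : φ = sp U s)
    (f : ∀ f : ℝ → ℝ, hermCFC f φ = sp U (fun i => f (s i)))
    {σ : Matrix n n ℂ} (hσ : IsDensity σ)
    (hσP : σ * sp U (fun i => if s i = 0 then 0 else 1) = σ) :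
    (Matrix.trace (φ * (matLog φ - ad K (matLog (ch K φ))))).re ≤
      (Matrix.trace (σ * (matLog φ - ad K (matLog (ch K φ))))).re := by
  set M := matLog φ - ad K (matLog (ch K φ)) with hM
  set P := sp U (fun i => if s i = 0 then 0 else 1) with hP
  set G := sp U (fun i => (s i)⁻¹) with hG
  have hGφ : G * φ = P := by
    rw [hG, e, sp_mul hU, hP]
    congr 1; ext i; by_cases h : s i = 0 <;> simp [h]
  have hφG : φ * G = P := by
    rw [hG, e, sp_mul hU, hP]
    congr 1; ext i; by_cases h : s i = 0 <;> simp [h]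
  have hφP : φ * P = φ := by
    rw [hP, e, sp_mul hU]
    congr 1; ext i; by_cases h : s i = 0 <;> simp [h]
  have hker : ∀ w, φ *ᵥ w = 0 → σ *ᵥ w = 0 := by
    intro w hw
    rw [← hσP, ← hGφ, ← Matrix.mulVec_mulVec, ← Matrix.mulVec_mulVec, hw]
    simp
  obtain ⟨U', s', hU', hs', e', f'⟩ := exists_spec (ch_psd K hφ.1)
  rw [← sub_nonpos]
  apply small_t (C := (Matrix.trace (σ * σ * G)).re - 1)
  intro t ht ht1
  have dt := mix_density hφ hσ ht ht1
  have hm := hmax _ dt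
  rw [obj_eq K φ, ← hM] at hm
  have hkt : ∀ w, φ *ᵥ w = 0 → (((1 - t : ℝ) : ℂ) • φ + (t : ℂ) • σ) *ᵥ w = 0 := by
    intro w hw
    rw [Matrix.add_mulVec, Matrix.smul_mulVec, Matrix.smul_mulVec, hw, hker w hw]
    simp
  have h1 := klein (ch_psd K dt.1) hU' hs' (diag_zero_of_ker hU' e' (ker_ch K hφ.1 hkt))
  have h2 := klein_upper dt.1 hU hs (diag_zero_of_ker hU e hkt)
  have hsum : ∑ i, s' i = 1 := by
    have := (ch_density K hK hφ).2
    rw [e', sp_trace hU'] at this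
    exact_mod_cast this
  have hL := f Real.log
  have hL' := f' Real.log
  change matLog φ = _ at hL
  change matLog (ch K φ) = _ at hL'
  rw [← hL', hsum, (ch_density K hK dt).2, ch_ad, mix_trace] at h1
  have hsq : (Matrix.trace ((((1 - t : ℝ) : ℂ) • φ + (t : ℂ) • σ) *
      (((1 - t : ℝ) : ℂ) • φ + (t : ℂ) • σ) * G)).re =
      1 - t ^ 2 + t ^ 2 * (Matrix.trace (σ * σ * G)).re := by
    have k : ∀ A : Matrix n n ℂ,
        (Matrix.trace (A * ((((1 - t : ℝ) : ℂ) • φ + (t : ℂ) • σ) * G))).re =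
        (1 - t) * (Matrix.trace (φ * (G * A))).re + t * (Matrix.trace (σ * (G * A))).re := by
      intro A
      rw [Matrix.trace_mul_comm, Matrix.mul_assoc, mix_trace]
    rw [Matrix.mul_assoc, mix_trace, k, k, hGφ, hφP, hσP, ← Matrix.mul_assoc φ G σ, hφG,
      Matrix.trace_mul_comm P, hσP, hφ.2, hσ.2, Matrix.trace_mul_comm (σ * σ) G,
      Matrix.trace_mul_comm σ (G * σ), Matrix.mul_assoc]
    simp
    ring
  rw [← hL, hsq, dt.2, mix_trace] at h2
  have hMφ : (Matrix.trace (φ * M)).re = (Matrix.trace (φ * matLog φ)).re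
      - (Matrix.trace (φ * ad K (matLog (ch K φ)))).re := by
    rw [hM, Matrix.mul_sub, Matrix.trace_sub, Complex.sub_re]
  have hMσ : (Matrix.trace (σ * M)).re = (Matrix.trace (σ * matLog φ)).re
      - (Matrix.trace (σ * ad K (matLog (ch K φ)))).re := by
    rw [hM, Matrix.mul_sub, Matrix.trace_sub, Complex.sub_re]
  rw [hMφ] at hm ⊢
  rw [hMσ]
  rw [Complex.one_re] at h1 h2
  apply le_of_mul_le_mul_left _ ht
  nlinarith
end opt

section final
variable {n m : Type*} [Fintype n] [DecidableEq n] [Fintype m] [DecidableEq m]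
variable {I : Type} [Fintype I]

lemma compress_psd {M P : Matrix n n ℂ} (hM : Mᴴ = M) (hP : Pᴴ = P) (hPP : P * P = P) (a : ℝ)
    (h : ∀ σ : Matrix n n ℂ, IsDensity σ → σ * P = σ → a ≤ (Matrix.trace (σ * M)).re) :
    (P * (M - (a : ℂ) • 1) * P).PosSemidef := by
  have hH : (P * (M - (a : ℂ) • 1) * P).IsHermitian := by
    unfold Matrix.IsHermitian
    simp [Matrix.conjTranspose_mul, hP, hM, Matrix.mul_assoc]
  refine Matrix.PosSemidef.of_dotProduct_mulVec_nonneg hH fun v => ?_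
  have him := hH.im_star_dotProduct_mulVec_self v
  refine Complex.le_def.2 ⟨?_, him.symm⟩
  set w := P *ᵥ v with hw
  have hPw : P *ᵥ w = w := by rw [hw, Matrix.mulVec_mulVec, hPP]
  have e1 : star v ⬝ᵥ ((P * (M - (a : ℂ) • 1) * P) *ᵥ v) =
      star w ⬝ᵥ (M *ᵥ w) - (a : ℂ) * (star w ⬝ᵥ w) := by
    rw [← Matrix.mulVec_mulVec, ← Matrix.mulVec_mulVec, ← hw, Matrix.dotProduct_mulVec]
    have : star v ᵥ* P = star w := by rw [hw, Matrix.star_mulVec, hP]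
    rw [this, Matrix.sub_mulVec, dotProduct_sub, Matrix.smul_mulVec, Matrix.one_mulVec,
      dotProduct_smul, smul_eq_mul]
  rw [e1]
  by_cases hw0 : w = 0
  · rw [hw0]; simp
  have hN : 0 < star w ⬝ᵥ w := Matrix.dotProduct_star_self_pos_iff.2 hw0
  obtain ⟨N, hNe⟩ : ∃ N : ℝ, star w ⬝ᵥ w = (N : ℂ) :=
    ⟨(star w ⬝ᵥ w).re, Complex.ext rfl (Complex.lt_def.1 hN).2.symm⟩
  rw [hNe] at hN ⊢
  have hN' : 0 < N := by exact_mod_cast hN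
  have hσ := h (((N⁻¹ : ℝ) : ℂ) • Matrix.vecMulVec w (star w)) ⟨?_, ?_⟩ ?_
  · rw [Matrix.smul_mul, Matrix.trace_smul, smul_eq_mul, Complex.re_ofReal_mul,
      Matrix.trace_mul_comm, Matrix.mul_vecMulVec, Matrix.trace_vecMulVec, dotProduct_comm,
      ← div_eq_inv_mul, le_div_iff₀ hN'] at hσ
    rw [Complex.sub_re, ← Complex.ofReal_mul, Complex.ofReal_re]
    simpa using hσ
  · exact (Matrix.posSemidef_vecMulVec_self_star w).smul (by exact_mod_cast (inv_pos.2 hN').le)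
  · rw [Matrix.trace_smul, Matrix.trace_vecMulVec, dotProduct_comm, hNe, smul_eq_mul,
      ← Complex.ofReal_mul, inv_mul_cancel₀ hN'.ne']
    simp
  · rw [Matrix.smul_mul, Matrix.vecMulVec_mul]
    congr 2
    have := congrArg star hPw
    rwa [Matrix.star_mulVec, hP] at this

lemma zero_of_trace {A U : Matrix n n ℂ} {s : n → ℝ} (hs : ∀ i, 0 ≤ s i)
    (hA : A.PosSemidef) (h : Matrix.trace (A * sp U s) = 0)
    (hAP : A * sp U (fun i => if s i = 0 then 0 else 1) = A) : A = 0 := by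
  rw [← hA.trace_eq_zero_iff, ← hAP, trace_sp]
  rw [trace_sp] at h
  have hB := hA.conjTranspose_mul_mul_same U
  rw [Finset.sum_eq_zero_iff_of_nonneg (fun i _ =>
    mul_nonneg hB.diag_nonneg (by exact_mod_cast hs i))] at h
  apply Finset.sum_eq_zero
  intro i hi
  have := h i hi
  by_cases hz : s i = 0
  · simp [hz]
  · have hz' : (s i : ℂ) ≠ 0 := by exact_mod_cast hz
    rw [(mul_eq_zero.1 this).resolve_right hz', zero_mul]

lemma part_one (K : I → Matrix m n ℂ) (hK : ∑ i, (K i)ᴴ * K i = 1) {φ : Matrix n n ℂ}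
    (hφ : IsDensity φ)
    (hmax : ∀ σ, IsDensity σ → vnEnt σ - vnEnt (ch K σ) ≤ vnEnt φ - vnEnt (ch K φ)) :
    ∃ lam : ℝ, matLog φ - ad K (matLog (ch K φ)) = (lam : ℂ) • suppProj φ := by
  obtain ⟨U, s, hU, hs, e, f⟩ := exists_spec hφ.1
  obtain ⟨U', s', hU', hs', e', f'⟩ := exists_spec (ch_psd K hφ.1)
  have hL := f Real.log
  have hL' := f' Real.log
  change matLog φ = _ at hL
  change matLog (ch K φ) = _ at hL'
  have hP : suppProj φ = sp U (fun i => if s i = 0 then 0 else 1) := f _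
  set P := sp U (fun i => if s i = 0 then 0 else 1) with hPdef
  set M := matLog φ - ad K (matLog (ch K φ)) with hM
  set a := (Matrix.trace (φ * M)).re with ha
  have hPh : Pᴴ = P := sp_herm _ _
  have hPP : P * P = P := by
    rw [hPdef, sp_mul hU]; congr 1; ext i; by_cases h : s i = 0 <;> simp [h]
  have hPφ : P * φ = φ := by
    rw [hPdef, e, sp_mul hU]; congr 1; ext i; by_cases h : s i = 0 <;> simp [h]
  have hφP : φ * P = φ := by
    rw [hPdef, e, sp_mul hU]; congr 1; ext i; by_cases h : s i = 0 <;> simp [h]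
  have hMh : Mᴴ = M := by
    rw [hM, Matrix.conjTranspose_sub, ad_conj, hL, hL', sp_herm, sp_herm]
  have hA := compress_psd hMh hPh hPP a fun σ hσ hσP =>
    first_order K hK hφ hmax hU hs e f hσ hσP
  -- the trace of `φ M` is real
  have htr : Matrix.trace (φ * M) = (a : ℂ) := by
    have hconj : star (Matrix.trace (φ * M)) = Matrix.trace (φ * M) := by
      rw [← Matrix.trace_conjTranspose, Matrix.conjTranspose_mul, hMh, hφ.1.1.eq,
        Matrix.trace_mul_comm]
    exact (Complex.conj_eq_iff_re.1 hconj).symm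
  have hA0 : P * (M - (a : ℂ) • 1) * P = 0 := by
    refine zero_of_trace (U := U) (s := s) hs hA ?_ ?_
    · rw [← e, Matrix.mul_assoc, hPφ, Matrix.trace_mul_comm, ← Matrix.mul_assoc, hφP,
        Matrix.mul_sub, Matrix.trace_sub, htr, Matrix.mul_smul, Matrix.mul_one,
        Matrix.trace_smul, hφ.2]
      simp
    · rw [← hPdef, Matrix.mul_assoc, hPP]
  have hPMP : P * M * P = (a : ℂ) • P := by
    rw [Matrix.mul_sub, Matrix.sub_mul, sub_eq_zero] at hA0
    rw [hA0]
    simp [hPP]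
  -- the off-support part
  set Q := sp U (fun i => if s i = 0 then 1 else 0) with hQ
  set R := sp U' (fun i => if s' i = 0 then 0 else 1) with hR
  have hPQ : P + Q = 1 := by
    rw [hPdef, hQ, sp_add, ← sp_one hU]; congr 1; ext i; by_cases h : s i = 0 <;> simp [h]
  have hRK : ∀ i, R * K i * Q = 0 := by
    intro i
    have hcol : ∀ j, s j = 0 → R * K i * sp U (Pi.single j 1) = 0 := fun j hj =>
      kill K hU hU' j (kill_p K hK hφ hmax hU hs e hU' hs' e' hL' j hj) i
    have hD : ∀ j, s j = 0 → ∀ k, (R * K i * U) k j = 0 := by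
      intro j hj k
      have h1 : R * K i * U * Matrix.diagonal (fun l => ((Pi.single j 1 : n → ℝ) l : ℂ)) = 0 := by
        have := congrArg (· * U) (hcol j hj)
        simp only [sp, Matrix.zero_mul] at this
        rw [← this]
        simp only [Matrix.mul_assoc, hU.1, Matrix.mul_one]
      have h2 := congrFun (congrFun h1 k) j
      rw [Matrix.mul_diagonal] at h2
      simpa using h2
    have : R * K i * U * Matrix.diagonal (fun l => ((if s l = 0 then 1 else 0 : ℝ) : ℂ)) = 0 := by
      ext k l
      rw [Matrix.mul_diagonal]
      by_cases h : s l = 0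
      · rw [hD l h k]; simp
      · simp [h]
    rw [hQ]
    unfold sp
    rw [← Matrix.mul_assoc, ← Matrix.mul_assoc, this, Matrix.zero_mul]
  have hLR : matLog (ch K φ) = matLog (ch K φ) * R := by
    rw [hL', hR, sp_mul hU']; congr 1; ext i; by_cases h : s' i = 0 <;> simp [h]
  have hMQ : M * Q = 0 := by
    rw [hM, Matrix.sub_mul]
    have h1 : matLog φ * Q = 0 := by
      rw [hL, hQ, sp_mul hU, ← sp_zero U]; congr 1; ext i; by_cases h : s i = 0 <;> simp [h]
    have h2 : ad K (matLog (ch K φ)) * Q = 0 := by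
      unfold ad
      rw [Matrix.sum_mul]
      apply Finset.sum_eq_zero; intro i _
      rw [hLR]
      calc _ = (K i)ᴴ * matLog (ch K φ) * (R * K i * Q) := by simp only [Matrix.mul_assoc]
        _ = 0 := by rw [hRK, Matrix.mul_zero]
    rw [h1, h2, sub_zero]
  have hQM : Q * M = 0 := by
    have := congrArg Matrix.conjTranspose hMQ
    rwa [Matrix.conjTranspose_mul, hMh, hQ, sp_herm, Matrix.conjTranspose_zero] at this
  refine ⟨a, ?_⟩
  rw [hP, ← hPMP]
  calc M = (P + Q) * M * (P + Q) := by rw [hPQ]; simp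
    _ = P * M * P := by
      rw [Matrix.add_mul, hQM, add_zero, Matrix.mul_add, Matrix.mul_assoc P M Q, hMQ]
      simp

lemma part_two (K : I → Matrix m n ℂ) (hK : ∑ i, (K i)ᴴ * K i = 1) {φ : Matrix n n ℂ}
    (hφ : IsDensity φ) (hpd : φ.PosDef) (lam : ℝ)
    (h : matLog φ - ad K (matLog (ch K φ)) = (lam : ℂ) • 1) {σ : Matrix n n ℂ}
    (hσ : IsDensity σ) : vnEnt σ - vnEnt (ch K σ) ≤ vnEnt φ - vnEnt (ch K φ) := by
  have hker : ∀ w, φ *ᵥ w = 0 → σ *ᵥ w = 0 := by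
    intro w hw
    have hw0 : w = 0 := by
      by_contra hne
      have := hpd.dotProduct_mulVec_pos hne
      rw [hw] at this
      simp at this
    rw [hw0, Matrix.mulVec_zero]
  have hd := dpi K hK hσ.1 hφ.1 hker
  rw [ch_ad, ← Complex.sub_re, ← Matrix.trace_sub, ← Matrix.mul_sub, h, Matrix.mul_smul,
    Matrix.mul_one, Matrix.trace_smul, hσ.2] at hd
  rw [obj_eq K φ, h, Matrix.mul_smul, Matrix.mul_one, Matrix.trace_smul, hφ.2]
  linarith
end final

/-- **Optimality condition for the thermodynamic capacity.** -/
theorem thermodynamic_capacity_optimality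
    {d dE : ℕ} (hd : 1 ≤ d) (hdE : 1 ≤ dE)
    {I : Type} [Fintype I]
    (K : I → Matrix (Fin dE) (Fin d) ℂ)
    (hK : ∑ i : I, (K i)ᴴ * K i = 1)
    -- the channel and its adjoint
    (chan : Matrix (Fin d) (Fin d) ℂ → Matrix (Fin dE) (Fin dE) ℂ)
    (hchan : ∀ X, chan X = ∑ i : I, K i * X * (K i)ᴴ)
    (chanAdj : Matrix (Fin dE) (Fin dE) ℂ → Matrix (Fin d) (Fin d) ℂ)
    (hchanAdj : ∀ Y, chanAdj Y = ∑ i : I, (K i)ᴴ * Y * K i) :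
    -- (i) necessary optimality condition
    (∀ φ : Matrix (Fin d) (Fin d) ℂ, IsDensity φ →
      (∀ σ : Matrix (Fin d) (Fin d) ℂ, IsDensity σ →
        vnEnt σ - vnEnt (chan σ) ≤ vnEnt φ - vnEnt (chan φ)) →
      ∃ lam : ℝ, matLog φ - chanAdj (matLog (chan φ)) = (lam : ℂ) • suppProj φ)
    ∧
    -- (ii) sufficiency for positive definite states
    (∀ φ : Matrix (Fin d) (Fin d) ℂ, IsDensity φ → φ.PosDef →
      (∃ lam : ℝ, matLog φ - chanAdj (matLog (chan φ)) = (lam : ℂ) • (1 : Matrix (Fin d) (Fin d) ℂ)) →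
      ∀ σ : Matrix (Fin d) (Fin d) ℂ, IsDensity σ →
        vnEnt σ - vnEnt (chan σ) ≤ vnEnt φ - vnEnt (chan φ)) := by
  obtain rfl : chan = ch K := funext hchan
  obtain rfl : chanAdj = ad K := funext hchanAdj
  exact ⟨fun φ hφ hmax => part_one K hK hφ hmax,
    fun φ hφ hpd ⟨lam, h⟩ σ hσ => part_two K hK hφ hpd lam h hσ⟩

end ThermalPaper
end
end

section
/- Channel entropy of a classical stochastic map: Let d ≥ 1 and let T : Fin d × Fin d → ℝ satisfy T(k,j) ≥ 0 for all k, j and Σ_k T(k,j) = 1 for every j (a column-stochastic matrix). Let N be the diagonal matrix on ℂ^d⊗ℂ^d with diagonal entries N((k,j),(k,j)) = T(k,j) (so N is a Choi matrix with d_B = d_R = d). Then the channel entropy of N satisfies: inf over density matrices ρ on ℂ^d of [ S((1⊗√ρ) N (1⊗√ρ)) − S(ρ) ] = min over j ∈ Fin d of ( −Σ_k T(k,j)·log T(k,j) ), with the convention 0·log 0 = 0. -/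
/-! Statement 14: Channel entropy of a classical stochastic map. -/

noncomputable section
open scoped Kronecker ComplexOrder
open Matrix

namespace ThermalPaper

variable {dB dR : ℕ}

/-! ### Three lines lemma for exponential sums -/

lemma threeLine {ι : Type*} [Fintype ι] (c : ι → ℂ) (α β : ι → ℝ) (M : ℝ)
    (h0 : ∀ t : ℝ, ‖∑ i, c i * Complex.exp (α i + β i * (t * Complex.I))‖ ≤ M)
    (h1 : ∀ t : ℝ, ‖∑ i, c i * Complex.exp (α i + β i * (1 + t * Complex.I))‖ ≤ M)
    (hM : ∑ i, c i * Complex.exp (α i + β i) = M) :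
    0 ≤ (∑ i, c i * β i * Complex.exp (α i + β i)).re := by
  set F : ℂ → ℂ := fun z => ∑ i, c i * Complex.exp (α i + β i * z) with hF
  have hMnn : 0 ≤ M := (norm_nonneg _).trans (h0 0)
  have hdiff : Differentiable ℂ F := by
    rw [hF]; fun_prop
  have hbd : BddAbove ((norm ∘ F) '' Complex.HadamardThreeLines.verticalClosedStrip 0 1) := by
    refine ⟨∑ i, ‖c i‖ * Real.exp (|α i| + |β i|), ?_⟩
    rintro _ ⟨z, hz, rfl⟩
    have hz' : 0 ≤ z.re ∧ z.re ≤ 1 := hz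
    simp only [Function.comp, hF]
    refine (norm_sum_le _ _).trans (Finset.sum_le_sum fun i _ => ?_)
    rw [norm_mul, Complex.norm_exp]
    gcongr
    simp only [Complex.add_re, Complex.ofReal_re, Complex.mul_re, Complex.ofReal_im, zero_mul,
      sub_zero]
    have : β i * z.re ≤ |β i| := by
      calc β i * z.re ≤ |β i| * z.re := by gcongr; exacts [hz'.1, le_abs_self _]
        _ ≤ |β i| * 1 := by gcongr; exact hz'.2
        _ = _ := mul_one _
    linarith [le_abs_self (α i)]
  have key : ∀ x : ℝ, x ∈ Set.Icc (0:ℝ) 1 → ‖F x‖ ≤ M := by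
    intro x hx
    have := Complex.HadamardThreeLines.norm_le_interp_of_mem_verticalClosedStrip₀₁' F
      (z := (x:ℂ)) (a := M) (b := M) (by simpa [Complex.HadamardThreeLines.verticalClosedStrip] using hx)
      hdiff.diffContOnCl hbd ?_ ?_
    · refine this.trans (le_of_eq ?_)
      rw [← Real.rpow_add_of_nonneg hMnn] <;> simp [hx.1, hx.2]
    · intro z hz
      have hz' : z.re = 0 := hz
      have h := h0 z.im
      have e : (z.im : ℂ) * Complex.I = z := by
        apply Complex.ext <;> simp [hz']
      rw [e] at h; exact h
    · intro z hz
      have hz' : z.re = 1 := hz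
      have h := h1 z.im
      have e : 1 + (z.im : ℂ) * Complex.I = z := by
        apply Complex.ext <;> simp [hz']
      rw [e] at h; exact h
  have hder : HasDerivAt F (∑ i, c i * β i * Complex.exp (α i + β i)) ((1:ℝ):ℂ) := by
    rw [hF]
    apply HasDerivAt.fun_sum
    intro i _
    have h := (((hasDerivAt_id' ((1:ℝ):ℂ)).const_mul (β i : ℂ)).const_add (α i : ℂ)).cexp.const_mul (c i)
    convert! h using 1
    simp; ring
  have hreal := hder.real_of_complex
  have hF1 : F ((1:ℝ):ℂ) = M := by simp [hF, ← hM]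
  have ht := (hasDerivAt_iff_tendsto_slope_left_right.1 hreal).1
  refine ge_of_tendsto ht ?_
  have hmem : Set.Ioo (0:ℝ) 1 ∈ nhdsWithin (1:ℝ) (Set.Iio 1) := Ioo_mem_nhdsLT (by norm_num)
  filter_upwards [hmem] with x hx
  rw [slope_def_field]
  apply div_nonneg_of_nonpos
  · rw [hF1, Complex.ofReal_re, sub_nonpos]
    exact ((Complex.re_le_norm _).trans (key x ⟨hx.1.le, hx.2.le⟩))
  · linarith [hx.2]

/-! ### Complex powers with `0 ^ w = 0` -/

def pw (w : ℂ) (x : ℝ) : ℂ := if x = 0 then 0 else Complex.exp (w * (Real.log x : ℂ))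

lemma pw_mul (w w' : ℂ) (x : ℝ) : pw w x * pw w' x = pw (w + w') x := by
  unfold pw; split_ifs
  · simp
  · rw [← Complex.exp_add]; ring_nf

lemma pw_one {x : ℝ} (hx : 0 ≤ x) : pw 1 x = x := by
  unfold pw; split_ifs with h
  · simp [h]
  · rw [one_mul, ← Complex.ofReal_exp, Real.exp_log (lt_of_le_of_ne hx (Ne.symm h))]

lemma pw_half {x : ℝ} (hx : 0 ≤ x) : pw (1/2) x = (Real.sqrt x : ℝ) := by
  unfold pw; split_ifs with h
  · simp [h]
  · rw [Real.sqrt_eq_rpow, Real.rpow_def_of_pos (lt_of_le_of_ne hx (Ne.symm h))]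
    push_cast; ring_nf

lemma pw_zero_mul (x : ℝ) : pw 0 x * (x:ℂ) = x := by
  unfold pw; split_ifs with h <;> simp [h]

lemma pw_star (w : ℂ) (x : ℝ) : star (pw w x) = pw (star w) x := by
  unfold pw; split_ifs with h
  · simp
  · simp only [Complex.star_def, ← Complex.exp_conj, map_mul, Complex.conj_ofReal]

lemma pw_norm_le {w : ℂ} (hw : w.re = 0) (x : ℝ) : ‖pw w x‖ ≤ 1 := by
  unfold pw; split_ifs with h
  · simp
  · rw [Complex.norm_exp]; simp [hw]

/-! ### Hilbert-Schmidt norm -/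

section hs
variable {n : Type*} [Fintype n] [DecidableEq n]

def hs (Z : Matrix n n ℂ) : ℝ := ∑ i, ∑ j, ‖Z i j‖ ^ 2

lemma hs_eq_trace (Z : Matrix n n ℂ) : (hs Z : ℂ) = Matrix.trace (star Z * Z) := by
  simp only [hs, Matrix.trace, Matrix.diag, Matrix.mul_apply, Matrix.star_apply]
  rw [Finset.sum_comm]
  push_cast
  refine Finset.sum_congr rfl fun i _ => Finset.sum_congr rfl fun j _ => ?_
  rw [Complex.star_def, ← Complex.normSq_eq_conj_mul_self, Complex.normSq_eq_norm_sq]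
  push_cast; rfl

lemma hs_star (Z : Matrix n n ℂ) : hs (star Z) = hs Z := by
  simp only [hs, Matrix.star_apply, norm_star]
  exact Finset.sum_comm

lemma hs_unitary_mul {U : Matrix n n ℂ} (hU : star U * U = 1) (Z : Matrix n n ℂ) :
    hs (U * Z) = hs Z := by
  have : (hs (U * Z) : ℂ) = hs Z := by
    rw [hs_eq_trace, hs_eq_trace, star_mul, mul_assoc, ← mul_assoc (star U), hU, one_mul]
  exact_mod_cast this

lemma hs_diag_mul {g : n → ℂ} (hg : ∀ i, ‖g i‖ ≤ 1) (Z : Matrix n n ℂ) :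
    hs (Matrix.diagonal g * Z) ≤ hs Z := by
  unfold hs
  refine Finset.sum_le_sum fun i _ => Finset.sum_le_sum fun j _ => ?_
  rw [Matrix.diagonal_mul, norm_mul]
  gcongr
  exact mul_le_of_le_one_left (norm_nonneg _) (hg i)

/-- `W diag(g) W*` -/
def HH (W : Matrix n n ℂ) (g : n → ℂ) : Matrix n n ℂ := W * Matrix.diagonal g * star W

lemma HH_star (W : Matrix n n ℂ) (g : n → ℂ) : star (HH W g) = HH W (star g) := by
  unfold HH
  simp only [star_mul, star_star, mul_assoc]
  congr 2
  rw [Matrix.star_eq_conjTranspose, Matrix.diagonal_conjTranspose]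

lemma HH_mul {W : Matrix n n ℂ} (hW : star W * W = 1) (g h : n → ℂ) :
    HH W g * HH W h = HH W (fun i => g i * h i) := by
  unfold HH
  rw [← Matrix.diagonal_mul_diagonal]
  calc _ = W * Matrix.diagonal g * (star W * W) * Matrix.diagonal h * star W := by
        simp only [mul_assoc]
    _ = _ := by rw [hW]; simp only [mul_assoc, one_mul]

lemma HH_trace {W : Matrix n n ℂ} (hW : star W * W = 1) (g : n → ℂ) :
    Matrix.trace (HH W g) = ∑ i, g i := by
  unfold HH
  rw [mul_assoc, Matrix.trace_mul_comm, mul_assoc, hW, mul_one, Matrix.trace_diagonal]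

lemma hs_HH_mul {W : Matrix n n ℂ} (hW : star W * W = 1) {g : n → ℂ} (hg : ∀ i, ‖g i‖ ≤ 1)
    (Z : Matrix n n ℂ) : hs (HH W g * Z) ≤ hs Z := by
  have hW' : star (star W) * star W = 1 := by rw [star_star]; exact mul_eq_one_comm.1 hW
  unfold HH
  rw [mul_assoc, mul_assoc, hs_unitary_mul hW]
  refine (hs_diag_mul hg _).trans ?_
  rw [hs_unitary_mul hW']

lemma hs_mul_HH {W : Matrix n n ℂ} (hW : star W * W = 1) {g : n → ℂ} (hg : ∀ i, ‖g i‖ ≤ 1)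
    (Z : Matrix n n ℂ) : hs (Z * HH W g) ≤ hs Z := by
  rw [← hs_star, star_mul, HH_star, ← hs_star Z]
  exact hs_HH_mul hW (fun i => by simpa using hg i) _

lemma HH_one (g : n → ℂ) : HH (1 : Matrix n n ℂ) g = Matrix.diagonal g := by
  simp [HH]

lemma norm_trace_mul_le {M : ℝ} (P Q : Matrix n n ℂ) (hP : hs P ≤ M) (hQ : hs Q ≤ M) :
    ‖Matrix.trace (P * Q)‖ ≤ M := by
  have hQ' : hs (star Q) ≤ M := by rwa [hs_star]
  have : ‖Matrix.trace (P * Q)‖ ≤ (hs P + hs (star Q)) / 2 := by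
    simp only [Matrix.trace, Matrix.diag, Matrix.mul_apply, hs, Matrix.star_apply, norm_star]
    rw [← Finset.sum_add_distrib, Finset.sum_div]
    refine (norm_sum_le _ _).trans (Finset.sum_le_sum fun i _ => ?_)
    rw [← Finset.sum_add_distrib, Finset.sum_div]
    refine (norm_sum_le _ _).trans (Finset.sum_le_sum fun j _ => ?_)
    rw [norm_mul]
    nlinarith [sq_nonneg (‖P i j‖ - ‖Q j i‖)]
  linarith

lemma trace_tri (U W : Matrix n n ℂ) (B : Matrix n n ℂ) (p q r : n → ℂ) :
    Matrix.trace (HH U p * B * Matrix.diagonal q * HH W r) =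
      ∑ t : n × n × n, ((star U * B) t.1 t.2.1 * W t.2.1 t.2.2 * (star W * U) t.2.2 t.1) *
        (p t.1 * q t.2.1 * r t.2.2) := by
  have : Matrix.trace (HH U p * B * Matrix.diagonal q * HH W r) =
      Matrix.trace (Matrix.diagonal p * ((star U * B) * (Matrix.diagonal q * (W *
        (Matrix.diagonal r * (star W * U)))))) := by
    unfold HH
    rw [mul_assoc, mul_assoc, mul_assoc, mul_assoc, Matrix.trace_mul_comm]
    simp only [mul_assoc]
  rw [this]
  simp only [Matrix.trace, Matrix.diag, Matrix.diagonal_mul, Fintype.sum_prod_type]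
  refine Finset.sum_congr rfl fun i _ => ?_
  rw [Matrix.mul_apply, Finset.mul_sum]
  refine Finset.sum_congr rfl fun j _ => ?_
  rw [Matrix.diagonal_mul, Matrix.mul_apply (M := W), Finset.mul_sum, Finset.mul_sum, Finset.mul_sum]
  refine Finset.sum_congr rfl fun l _ => ?_
  rw [Matrix.diagonal_mul]
  ring

end hs

lemma pw_eq (w : ℂ) (x : ℝ) : pw w x = pw 0 x * Complex.exp (w * (Real.log x : ℂ)) := by
  unfold pw; split_ifs <;> simp

lemma pw_log {x : ℝ} (hx : 0 ≤ x) : (Real.log x : ℂ) * pw 1 x = ((x * Real.log x : ℝ) : ℂ) := by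
  rw [pw_one hx]; push_cast; ring

section main
variable {n : Type*} [Fintype n] [DecidableEq n]

lemma absorb {P Z X : Matrix n n ℂ} (ZZ : Z * star Z = X) (e1 : P * X = X) (e2 : X * P = X)
    (hP : star P = P) : P * Z = Z := by
  have h1 : (star Z - star Z * P) = 0 := by
    rw [← Matrix.conjTranspose_mul_self_eq_zero, ← Matrix.star_eq_conjTranspose]
    rw [star_sub, star_mul, hP, star_star]
    have : (Z - P * Z) * (star Z - star Z * P) =
      Z * star Z - (Z * star Z) * P - P * (Z * star Z)
        + P * (Z * star Z) * P := by noncomm_ring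
    rw [this, ZZ, e1, e2]; noncomm_ring
  have h2 := congrArg star h1
  rw [star_sub, star_mul, hP, star_star, star_zero, sub_eq_zero] at h2
  exact h2.symm

set_option maxHeartbeats 1000000 in
lemma main_ineq {U W : Matrix n n ℂ} (hU : star U * U = 1) (hW : star W * W = 1)
    (x a b : n → ℝ) (hx : ∀ i, 0 ≤ x i) (ha : ∀ i, 0 ≤ a i) (hb : ∀ i, 0 ≤ b i)
    (hX : HH U (fun i => (x i : ℂ)) = HH W (fun i => (Real.sqrt (b i) : ℂ)) *
      Matrix.diagonal (fun i => (a i : ℂ)) * HH W (fun i => (Real.sqrt (b i) : ℂ))) :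
    ∑ i, x i * Real.log (x i) ≤
      ∑ j, a j * Real.log (a j) * (HH W (fun i => (b i : ℂ)) j j).re +
      ∑ j, a j * (HH W (fun i => ((b i * Real.log (b i) : ℝ) : ℂ)) j j).re := by
  obtain ⟨XP, hXP⟩ : ∃ f : ℂ → Matrix n n ℂ, f = fun w => HH U (fun i => pw w (x i)) := ⟨_, rfl⟩
  obtain ⟨BP, hBP⟩ : ∃ f : ℂ → Matrix n n ℂ, f = fun w => HH W (fun i => pw w (b i)) := ⟨_, rfl⟩
  obtain ⟨AP, hAP⟩ : ∃ f : ℂ → Matrix n n ℂ, f = fun w => Matrix.diagonal (fun i => pw w (a i)) := ⟨_, rfl⟩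
  have XPmul : ∀ w w', XP w * XP w' = XP (w + w') := fun w w' => by
    simp only [hXP, HH_mul hU, pw_mul]
  have BPmul : ∀ w w', BP w * BP w' = BP (w + w') := fun w w' => by
    simp only [hBP, HH_mul hW, pw_mul]
  have APmul : ∀ w w', AP w * AP w' = AP (w + w') := fun w w' => by
    simp only [hAP, Matrix.diagonal_mul_diagonal, pw_mul]
  have XPstar : ∀ w, star (XP w) = XP (star w) := fun w => by
    simp only [hXP, HH_star]; congr 1; ext i; simp [pw_star]
  have BPstar : ∀ w, star (BP w) = BP (star w) := fun w => by
    simp only [hBP, HH_star]; congr 1; ext i; simp [pw_star]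
  have APstar : ∀ w, star (AP w) = AP (star w) := fun w => by
    simp only [hAP, Matrix.star_eq_conjTranspose, Matrix.diagonal_conjTranspose]
    congr 1; ext i; simp [pw_star]
  have XPc : ∀ w : ℂ, w.re = 0 → ∀ Z, hs (XP w * Z) ≤ hs Z := fun w hw Z => by
    rw [hXP]; exact hs_HH_mul hU (fun i => pw_norm_le hw _) _
  have BPc : ∀ w : ℂ, w.re = 0 → ∀ Z, hs (Z * BP w) ≤ hs Z := fun w hw Z => by
    rw [hBP]; exact hs_mul_HH hW (fun i => pw_norm_le hw _) _
  have h1u : star (1 : Matrix n n ℂ) * 1 = 1 := by simp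
  have APc : ∀ w : ℂ, w.re = 0 → ∀ Z, hs (Z * AP w) ≤ hs Z := fun w hw Z => by
    rw [hAP]; simp only [← HH_one]; exact hs_mul_HH h1u (fun i => pw_norm_le hw _) _
  have APc' : ∀ w : ℂ, w.re = 0 → ∀ Z, hs (AP w * Z) ≤ hs Z := fun w hw Z => by
    rw [hAP]; simp only [← HH_one]; exact hs_HH_mul h1u (fun i => pw_norm_le hw _) _
  have hhalf : star (1/2 : ℂ) = 1/2 := by simp
  have hX' : XP 1 = BP (1/2) * AP 1 * BP (1/2) := by
    simp only [hXP, hBP, hAP, pw_one (hx _), pw_one (ha _), pw_half (hb _)]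
    exact hX
  set M : ℝ := ∑ i, x i with hM
  have trX : Matrix.trace (XP 1) = M := by
    simp only [hXP, HH_trace hU, pw_one (hx _), hM]; push_cast; rfl
  obtain ⟨Z, hZ⟩ : ∃ Z : Matrix n n ℂ, Z = BP (1/2) * AP (1/2) := ⟨_, rfl⟩
  have starZ : star Z = AP (1/2) * BP (1/2) := by
    rw [hZ, star_mul, BPstar, APstar, hhalf]
  have ZZ : Z * star Z = XP 1 := by
    rw [starZ, hZ, hX', mul_assoc, ← mul_assoc (AP (1/2)), APmul, mul_assoc]; norm_num
  have hsZ' : hs (star Z) = M := by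
    have : (hs (star Z) : ℂ) = M := by rw [hs_eq_trace, star_star, ZZ, trX]
    exact_mod_cast this
  have hsZ : hs Z = M := by rw [← hsZ', hs_star]
  have habs : XP 0 * Z = Z := by
    exact absorb ZZ (by rw [XPmul, zero_add]) (by rw [XPmul, add_zero]) (by rw [XPstar, star_zero])
  have habs' : XP 0 * BP (1/2) * AP 1 = BP (1/2) * AP 1 := by
    have : AP 1 = AP (1/2) * AP (1/2) := by rw [APmul]; norm_num
    rw [this, ← mul_assoc, mul_assoc (XP 0), ← hZ, habs, ← mul_assoc, ← hZ]
  obtain ⟨c0, hc0⟩ : ∃ f : n × n × n → ℂ, f = fun t => ((star U * BP (1/2)) t.1 t.2.1 * W t.2.1 t.2.2 *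
    (star W * U) t.2.2 t.1) := ⟨_, rfl⟩
  obtain ⟨c, hc⟩ : ∃ f : n × n × n → ℂ, f = fun t => c0 t * (pw 0 (x t.1) * pw 0 (a t.2.1) * pw 0 (b t.2.2)) := ⟨_, rfl⟩
  obtain ⟨α, hα⟩ : ∃ f : n × n × n → ℝ, f = fun t => Real.log (x t.1) / 2 + Real.log (a t.2.1) / 2 := ⟨_, rfl⟩
  obtain ⟨β, hβ⟩ : ∃ f : n × n × n → ℝ, f = fun t => -Real.log (x t.1) / 2 + Real.log (a t.2.1) / 2
    + Real.log (b t.2.2) / 2 := ⟨_, rfl⟩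
  have term : ∀ z : ℂ, ∀ t, c t * Complex.exp (α t + β t * z) =
      c0 t * (pw ((1 - z)/2) (x t.1) * pw ((1 + z)/2) (a t.2.1) * pw (z/2) (b t.2.2)) := by
    intro z t
    rw [pw_eq ((1 - z)/2), pw_eq ((1+z)/2), pw_eq (z/2)]
    have : Complex.exp (α t + β t * z) = Complex.exp ((1 - z)/2 * (Real.log (x t.1) : ℂ)) *
      Complex.exp ((1 + z)/2 * (Real.log (a t.2.1) : ℂ)) *
      Complex.exp (z/2 * (Real.log (b t.2.2) : ℂ)) := by
      rw [← Complex.exp_add, ← Complex.exp_add]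
      congr 1
      simp only [hα, hβ]; push_cast; ring
    rw [this]; simp only [hc]; ring
  have hF : ∀ z : ℂ, ∑ t, c t * Complex.exp (α t + β t * z) =
      Matrix.trace (XP ((1 - z)/2) * BP (1/2) * AP ((1 + z)/2) * BP (z/2)) := by
    intro z
    simp only [term]
    have h := trace_tri U W (BP (1/2)) (fun i => pw ((1 - z)/2) (x i))
      (fun i => pw ((1 + z)/2) (a i)) (fun i => pw (z/2) (b i))
    have e1 : HH U (fun i => pw ((1 - z)/2) (x i)) = XP ((1 - z)/2) := by rw [hXP]
    have e2 : Matrix.diagonal (fun i => pw ((1 + z)/2) (a i)) = AP ((1 + z)/2) := by rw [hAP]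
    have e3 : HH W (fun i => pw (z/2) (b i)) = BP (z/2) := by rw [hBP]
    rw [e1, e2, e3] at h
    rw [h, hc0]
  have hre : ∀ t : ℝ, ((t:ℂ) * Complex.I / 2).re = 0 := fun t => by simp
  have hre' : ∀ t : ℝ, (-((t:ℂ) * Complex.I / 2)).re = 0 := fun t => by simp
  have hXhalf : hs (XP (1/2)) = M := by
    have : (hs (XP (1/2)) : ℂ) = M := by
      rw [hs_eq_trace, XPstar, hhalf, XPmul, ← trX]; norm_num
    exact_mod_cast this
  have hder := threeLine c α β M ?_ ?_ ?_
  rotate_left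
  · intro t
    rw [hF]
    have e : XP ((1 - t * Complex.I)/2) * BP (1/2) * AP ((1 + t * Complex.I)/2) *
        BP (t * Complex.I/2) =
        (XP (-(t * Complex.I/2)) * XP (1/2)) * ((Z * AP (t * Complex.I/2)) *
          BP (t * Complex.I/2)) := by
      rw [hZ, mul_assoc (BP (1/2)), XPmul, APmul]
      simp only [mul_assoc]
      congr 4 <;> ring
    rw [e]
    apply norm_trace_mul_le
    · exact (XPc _ (hre' t) _).trans hXhalf.le
    · refine (BPc _ (hre t) _).trans ?_
      exact (APc _ (hre t) _).trans hsZ.le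
  · intro t
    rw [hF]
    have e : XP ((1 - (1 + t * Complex.I))/2) * BP (1/2) * AP ((1 + (1 + t * Complex.I))/2) *
        BP ((1 + t * Complex.I)/2) =
        (XP (-(t * Complex.I/2)) * Z) * (AP (t * Complex.I/2) * (star Z *
          BP (t * Complex.I/2))) := by
      have e1 : AP ((1 + (1 + t * Complex.I))/2) =
        AP (1/2) * (AP (t * Complex.I/2) * AP (1/2)) := by
        rw [APmul, APmul]; congr 1; ring
      have e2 : BP ((1 + t * Complex.I)/2) = BP (1/2) * BP (t * Complex.I/2) := by
        rw [BPmul]; congr 1; ring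
      rw [starZ, hZ, e1, e2]
      simp only [mul_assoc]
      congr 2; ring
    rw [e]
    apply norm_trace_mul_le
    · exact (XPc _ (hre' t) _).trans hsZ.le
    · refine (APc' _ (hre t) _).trans ?_
      exact (BPc _ (hre t) _).trans hsZ'.le
  · have := hF 1
    simp only [mul_one] at this
    rw [this, ← trX]
    norm_num
    rw [habs', ← hX']
  have hsum : ∑ t, c t * β t * Complex.exp (α t + β t) =
      (1/2 : ℂ) * (- Matrix.trace (HH U (fun i => (Real.log (x i) : ℂ) * pw 0 (x i)) *
          BP (1/2) * AP 1 * BP (1/2))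
        + Matrix.trace (XP 0 * BP (1/2) *
          Matrix.diagonal (fun i => (Real.log (a i) : ℂ) * pw 1 (a i)) * BP (1/2))
        + Matrix.trace (XP 0 * BP (1/2) * AP 1 *
          HH W (fun i => (Real.log (b i) : ℂ) * pw (1/2) (b i)))) := by
    simp only [hXP, hBP, hAP]
    rw [trace_tri, trace_tri, trace_tri, ← Finset.sum_neg_distrib, ← Finset.sum_add_distrib,
      ← Finset.sum_add_distrib, Finset.mul_sum]
    refine Finset.sum_congr rfl fun t _ => ?_
    have h := term 1 t
    norm_num at h
    rw [mul_right_comm, h]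
    simp only [hc0, hβ, hBP]
    norm_num
    ring
  rw [hsum] at hder
  have T1 : Matrix.trace (HH U (fun i => (Real.log (x i) : ℂ) * pw 0 (x i)) *
          BP (1/2) * AP 1 * BP (1/2)) = ((∑ i, x i * Real.log (x i) : ℝ) : ℂ) := by
    rw [mul_assoc, mul_assoc, ← mul_assoc (BP (1/2)), ← hX']
    simp only [hXP]
    rw [HH_mul hU, HH_trace hU]
    push_cast
    refine Finset.sum_congr rfl fun i _ => ?_
    rw [mul_assoc, pw_mul, zero_add, pw_one (hx i), mul_comm]
  have T2 : Matrix.trace (XP 0 * BP (1/2) *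
          Matrix.diagonal (fun i => (Real.log (a i) : ℂ) * pw 1 (a i)) * BP (1/2)) =
      ∑ j, ((a j * Real.log (a j) : ℝ) : ℂ) * (HH W (fun i => (b i : ℂ)) j j) := by
    have e : Matrix.diagonal (fun i => (Real.log (a i) : ℂ) * pw 1 (a i)) =
        AP 1 * Matrix.diagonal (fun i => (Real.log (a i) : ℂ)) := by
      simp only [hAP, Matrix.diagonal_mul_diagonal, mul_comm]
    rw [e, ← mul_assoc, habs', mul_assoc (BP (1/2)), ← e, Matrix.trace_mul_comm, ← mul_assoc,
      BPmul, Matrix.trace_mul_comm]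
    simp only [Matrix.trace, Matrix.diag, Matrix.diagonal_mul, pw_log (ha _)]
    norm_num
    simp only [hBP, pw_one (hb _)]
  have T3 : Matrix.trace (XP 0 * BP (1/2) * AP 1 *
          HH W (fun i => (Real.log (b i) : ℂ) * pw (1/2) (b i))) =
      ∑ j, (a j : ℂ) * (HH W (fun i => ((b i * Real.log (b i) : ℝ) : ℂ)) j j) := by
    rw [habs', mul_assoc, Matrix.trace_mul_comm, mul_assoc]
    have e : HH W (fun i => (Real.log (b i) : ℂ) * pw (1/2) (b i)) * BP (1/2) =
        HH W (fun i => ((b i * Real.log (b i) : ℝ) : ℂ)) := by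
      simp only [hBP]
      rw [HH_mul hW]
      congr 1; ext i
      rw [mul_assoc, pw_mul, ← pw_log (hb i)]; norm_num
    rw [e]
    simp only [hAP, Matrix.trace, Matrix.diag, Matrix.diagonal_mul, pw_one (ha _)]
  rw [T1, T2, T3] at hder
  have hh : (1/2 : ℂ) = ((1/2 : ℝ) : ℂ) := by norm_num
  rw [hh, Complex.re_ofReal_mul] at hder
  simp only [Complex.add_re, Complex.neg_re, Complex.ofReal_re, Complex.re_sum,
    Complex.re_ofReal_mul] at hder
  linarith

end main

section cfc
variable {n : Type*} [Fintype n] [DecidableEq n]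

lemma HH_intertwine {V W : Matrix n n ℂ} (hV : star V * V = 1) (hW : star W * W = 1)
    {l w : n → ℝ} (h : HH V (fun i => (l i : ℂ)) = HH W (fun i => (w i : ℂ))) (f : ℝ → ℝ) :
    HH V (fun i => (f (l i) : ℂ)) = HH W (fun i => (f (w i) : ℂ)) := by
  have hV' : V * star V = 1 := mul_eq_one_comm.1 hV
  have hW' : W * star W = 1 := mul_eq_one_comm.1 hW
  have hC : (star W * V) * Matrix.diagonal (fun i => (l i : ℂ)) =
      Matrix.diagonal (fun i => (w i : ℂ)) * (star W * V) := by
    calc _ = star W * HH V (fun i => (l i : ℂ)) * V := by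
          unfold HH
          calc _ = star W * (V * Matrix.diagonal (fun i => (l i : ℂ))) * 1 := by
                rw [mul_one, mul_assoc]
            _ = _ := by rw [← hV]; simp only [mul_assoc]
      _ = star W * HH W (fun i => (w i : ℂ)) * V := by rw [h]
      _ = (star W * W) * (Matrix.diagonal (fun i => (w i : ℂ)) * (star W * V)) := by
          unfold HH; simp only [mul_assoc]
      _ = _ := by rw [hW, one_mul]
  have hC' : (star W * V) * Matrix.diagonal (fun i => (f (l i) : ℂ)) =
      Matrix.diagonal (fun i => (f (w i) : ℂ)) * (star W * V) := by
    ext i j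
    have := congrFun (congrFun hC i) j
    rw [Matrix.mul_diagonal, Matrix.diagonal_mul] at this ⊢
    by_cases h0 : (star W * V) i j = 0
    · simp [h0]
    · have h2 : (l j : ℂ) = w i := by
        apply mul_left_cancel₀ h0; rw [this, mul_comm]
      have h3 : l j = w i := by exact_mod_cast h2
      rw [h3, mul_comm]
  calc HH V (fun i => (f (l i) : ℂ))
      = W * ((star W * V) * Matrix.diagonal (fun i => (f (l i) : ℂ))) * star V := by
        unfold HH
        calc _ = 1 * (V * Matrix.diagonal (fun i => (f (l i) : ℂ)) * star V) := by rw [one_mul]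
          _ = _ := by rw [← hW']; simp only [mul_assoc]
    _ = W * Matrix.diagonal (fun i => (f (w i) : ℂ)) * star W * (V * star V) := by
        rw [hC']; simp only [mul_assoc]
    _ = _ := by rw [hV', mul_one]; rfl

lemma eig_unitary {A : Matrix n n ℂ} (hA : A.IsHermitian) :
    star (hA.eigenvectorUnitary : Matrix n n ℂ) * (hA.eigenvectorUnitary : Matrix n n ℂ) = 1 :=
  Unitary.coe_star_mul_self _

lemma eig_spec {A : Matrix n n ℂ} (hA : A.IsHermitian) :
    HH (hA.eigenvectorUnitary : Matrix n n ℂ) (fun i => (hA.eigenvalues i : ℂ)) = A := by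
  conv_rhs => rw [hA.spectral_theorem, Unitary.conjStarAlgAut_apply]
  rfl

lemma HH_herm (W : Matrix n n ℂ) (w : n → ℝ) : (HH W (fun i => (w i : ℂ))).IsHermitian := by
  change star _ = _
  rw [HH_star]; congr 1; ext i; simp

lemma hermCFC_HH {W : Matrix n n ℂ} (hW : star W * W = 1) (w : n → ℝ) (f : ℝ → ℝ) :
    hermCFC f (HH W (fun i => (w i : ℂ))) = HH W (fun i => (f (w i) : ℂ)) := by
  unfold hermCFC
  rw [dif_pos (HH_herm W w)]
  exact HH_intertwine (eig_unitary _) hW (eig_spec (HH_herm W w)) f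

lemma vnEnt_HH {W : Matrix n n ℂ} (hW : star W * W = 1) (w : n → ℝ) :
    vnEnt (HH W (fun i => (w i : ℂ))) = -∑ i, w i * Real.log (w i) := by
  unfold vnEnt matLog
  rw [hermCFC_HH hW, HH_mul hW, HH_trace hW]
  simp

lemma kron_HH {m : Type*} [Fintype m] [DecidableEq m] (V : Matrix n n ℂ) (g : n → ℂ) :
    (1 : Matrix m m ℂ) ⊗ₖ HH V g = HH ((1 : Matrix m m ℂ) ⊗ₖ V) (fun p => g p.2) := by
  unfold HH
  have e : Matrix.diagonal (fun p : m × n => g p.2) = (1 : Matrix m m ℂ) ⊗ₖ Matrix.diagonal g := by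
    rw [← Matrix.diagonal_one, Matrix.diagonal_kronecker_diagonal]; simp
  rw [e, Matrix.star_eq_conjTranspose ((1 : Matrix m m ℂ) ⊗ₖ V), Matrix.conjTranspose_kronecker,
    ← Matrix.mul_kronecker_mul, ← Matrix.mul_kronecker_mul]
  simp [Matrix.star_eq_conjTranspose]

end cfc

lemma condEnt_lower {d : ℕ} (T : Fin d × Fin d → ℝ) (hT0 : ∀ p, 0 ≤ T p)
    (hT1 : ∀ j : Fin d, ∑ k : Fin d, T (k, j) = 1)
    (ρ : Matrix (Fin d) (Fin d) ℂ) (hρ : IsDensity ρ) :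
    ∑ j, (ρ j j).re * (-∑ k : Fin d, T (k, j) * Real.log (T (k, j))) ≤
      condEnt (dB := d) ρ (Matrix.diagonal fun p => (T p : ℂ)) := by
  obtain ⟨hpsd, htr⟩ := hρ
  have hA := hpsd.isHermitian
  obtain ⟨V, hVd⟩ : ∃ V : Matrix (Fin d) (Fin d) ℂ, V = hA.eigenvectorUnitary := ⟨_, rfl⟩
  obtain ⟨l, hld⟩ : ∃ l, l = hA.eigenvalues := ⟨_, rfl⟩
  have hV : star V * V = 1 := by rw [hVd]; exact eig_unitary hA
  have hl : ∀ i, 0 ≤ l i := by rw [hld]; exact hpsd.eigenvalues_nonneg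
  have hρe : HH V (fun i => (l i : ℂ)) = ρ := by rw [hVd, hld]; exact eig_spec hA
  have hW : star ((1 : Matrix (Fin d) (Fin d) ℂ) ⊗ₖ V) * ((1 : Matrix (Fin d) (Fin d) ℂ) ⊗ₖ V) = 1 := by
    rw [Matrix.star_eq_conjTranspose, Matrix.conjTranspose_kronecker, ← Matrix.mul_kronecker_mul,
      ← Matrix.star_eq_conjTranspose V, hV]
    simp
  have hsq : matSqrt ρ = HH V (fun i => (Real.sqrt (l i) : ℂ)) := by
    rw [← hρe]; exact hermCFC_HH hV l _
  unfold condEnt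
  rw [hsq, kron_HH]
  obtain ⟨W, hWd⟩ : ∃ W, W = (1 : Matrix (Fin d) (Fin d) ℂ) ⊗ₖ V := ⟨_, rfl⟩
  rw [← hWd] at hW ⊢
  obtain ⟨X, hX⟩ : ∃ X, X = HH W (fun p => (Real.sqrt (l p.2) : ℂ)) *
      Matrix.diagonal (fun p => (T p : ℂ)) * HH W (fun p => (Real.sqrt (l p.2) : ℂ)) := ⟨_, rfl⟩
  rw [← hX]
  have hXpsd : X.PosSemidef := by
    have hD : (Matrix.diagonal (fun p => (T p : ℂ))).PosSemidef :=
      Matrix.PosSemidef.diagonal (fun p => by simpa using hT0 p)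
    have h := hD.mul_mul_conjTranspose_same (HH W (fun p => (Real.sqrt (l p.2) : ℂ)))
    rw [(HH_herm W (fun p => Real.sqrt (l p.2))).eq] at h
    rwa [hX]
  have hXh := hXpsd.isHermitian
  have hmain := main_ineq (eig_unitary hXh) hW hXh.eigenvalues T (fun p => l p.2)
    hXpsd.eigenvalues_nonneg hT0 (fun p => hl p.2) ((eig_spec hXh).trans hX)
  have hSX : vnEnt X = -∑ i, hXh.eigenvalues i * Real.log (hXh.eigenvalues i) := by
    conv_lhs => rw [← eig_spec hXh]
    exact vnEnt_HH (eig_unitary hXh) _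
  have hSρ : vnEnt ρ = -∑ i, l i * Real.log (l i) := by
    rw [← hρe]; exact vnEnt_HH hV _
  have hdiag : ∀ (g : Fin d → ℂ) (p : Fin d × Fin d),
      HH W (fun p => g p.2) p p = HH V g p.2 p.2 := by
    intro g p
    rw [hWd, ← kron_HH]
    simp [Matrix.kroneckerMap_apply]
  have e1 : ∑ p : Fin d × Fin d, T p * Real.log (T p) *
      (HH W (fun p => ((l p.2 : ℝ) : ℂ)) p p).re =
      ∑ j, (ρ j j).re * (∑ k : Fin d, T (k, j) * Real.log (T (k, j))) := by
    rw [Fintype.sum_prod_type_right]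
    refine Finset.sum_congr rfl fun j _ => ?_
    rw [Finset.mul_sum]
    refine Finset.sum_congr rfl fun k _ => ?_
    rw [hdiag (fun i => (l i : ℂ)), hρe, mul_comm]
  have e2 : ∑ p : Fin d × Fin d, T p *
      (HH W (fun p => ((l p.2 * Real.log (l p.2) : ℝ) : ℂ)) p p).re =
      ∑ i, l i * Real.log (l i) := by
    rw [Fintype.sum_prod_type_right]
    have ht := congrArg Complex.re (HH_trace hV (fun i => ((l i * Real.log (l i) : ℝ) : ℂ)))
    rw [← Complex.ofReal_sum, Complex.ofReal_re] at ht
    rw [← ht, Matrix.trace, Complex.re_sum]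
    refine Finset.sum_congr rfl fun j _ => ?_
    simp only [hdiag (fun i => ((l i * Real.log (l i) : ℝ) : ℂ))]
    rw [← Finset.sum_mul, hT1, one_mul]; rfl
  rw [e1, e2] at hmain
  rw [hSX, hSρ]
  simp only [mul_neg, Finset.sum_neg_distrib]
  linarith

lemma condEnt_basis {d : ℕ} (T : Fin d × Fin d → ℝ) (j : Fin d) :
    IsDensity (Matrix.diagonal (fun i : Fin d => ((if i = j then 1 else 0 : ℝ) : ℂ))) ∧
    condEnt (dB := d) (Matrix.diagonal (fun i : Fin d => ((if i = j then 1 else 0 : ℝ) : ℂ)))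
      (Matrix.diagonal fun p => (T p : ℂ)) = -∑ k : Fin d, T (k, j) * Real.log (T (k, j)) := by
  have h1 : ∀ {m : Type} [Fintype m] [DecidableEq m], star (1 : Matrix m m ℂ) * 1 = 1 := by
    intros; simp
  refine ⟨⟨Matrix.PosSemidef.diagonal fun i => ?_, ?_⟩, ?_⟩
  · simp only [Pi.zero_apply]; split_ifs <;> simp
  · rw [Matrix.trace_diagonal, ← Complex.ofReal_sum]; simp
  · unfold condEnt matSqrt
    rw [← HH_one, hermCFC_HH h1, vnEnt_HH h1, kron_HH, Matrix.one_kronecker_one, HH_one,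
      Matrix.diagonal_mul_diagonal, Matrix.diagonal_mul_diagonal, ← HH_one]
    have e : (fun p : Fin d × Fin d => ((Real.sqrt (if p.2 = j then 1 else 0) : ℝ) : ℂ) * (T p : ℂ) *
        ((Real.sqrt (if p.2 = j then 1 else 0) : ℝ) : ℂ)) =
        fun p => ((if p.2 = j then T p else 0 : ℝ) : ℂ) := by
      ext p; split_ifs <;> simp
    rw [e, vnEnt_HH h1, Fintype.sum_prod_type]
    have e2 : ∀ k i : Fin d, (if i = j then T (k, i) else 0) *
        Real.log (if i = j then T (k, i) else 0) =
        if i = j then T (k, i) * Real.log (T (k, i)) else 0 := by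
      intro k i; split_ifs <;> simp
    have e3 : ∀ i : Fin d, (if i = j then (1:ℝ) else 0) * Real.log (if i = j then 1 else 0) = 0 := by
      intro i; split_ifs <;> simp
    simp only [e2, e3]
    simp

/-- **Channel entropy of a classical (column-)stochastic map.** -/
theorem classical_channel_entropy
    {d : ℕ} (hd : 1 ≤ d)
    (T : Fin d × Fin d → ℝ)
    (hT0 : ∀ p, 0 ≤ T p)
    (hT1 : ∀ j : Fin d, ∑ k : Fin d, T (k, j) = 1) :
    chanEnt (dB := d) (dR := d) (Matrix.diagonal fun p => (T p : ℂ))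
      = ⨅ j : Fin d, -∑ k : Fin d, T (k, j) * Real.log (T (k, j)) := by
  haveI : Nonempty (Fin d) := ⟨⟨0, hd⟩⟩
  have hbdd : BddBelow (Set.range fun j : Fin d => -∑ k : Fin d, T (k, j) * Real.log (T (k, j))) :=
    (Set.finite_range _).bddBelow
  have hlow : ∀ x ∈ {x : ℝ | ∃ ρ : Matrix (Fin d) (Fin d) ℂ, IsDensity ρ ∧
      condEnt (dB := d) ρ (Matrix.diagonal fun p => (T p : ℂ)) = x},
      (⨅ j : Fin d, -∑ k : Fin d, T (k, j) * Real.log (T (k, j))) ≤ x := by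
    rintro x ⟨ρ, hρ, rfl⟩
    refine le_trans ?_ (condEnt_lower T hT0 hT1 ρ hρ)
    have hs1 : ∑ j, (ρ j j).re = 1 := by
      have := congrArg Complex.re hρ.2
      simpa [Matrix.trace] using this
    calc _ = ∑ j, (ρ j j).re * (⨅ j : Fin d, -∑ k : Fin d, T (k, j) * Real.log (T (k, j))) := by
          rw [← Finset.sum_mul, hs1, one_mul]
      _ ≤ _ := by
          refine Finset.sum_le_sum fun j _ => mul_le_mul_of_nonneg_left (ciInf_le hbdd j) ?_
          exact (Complex.le_def.1 (hρ.1.diag_nonneg (i := j))).1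
  unfold chanEnt
  apply le_antisymm
  · refine le_ciInf fun j => csInf_le ⟨_, hlow⟩ ?_
    exact ⟨_, condEnt_basis T j⟩
  · refine le_csInf ?_ hlow
    exact ⟨_, _, condEnt_basis T ⟨0, hd⟩⟩

end ThermalPaper
end
end
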